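/- arXiv:1701.04086 — 10 statements merged into one kernel-verified Lean document; each statement's English description precedes it below -/
import Mathlib

section
/- Let A be a finite set and let α, β be strict subsets of A with α ∪ β = A. For every k ≥ 1 and all tuples x, y, z ∈ A^k the following are equivalent: (1) there exists j ∈ {1,…,k} with (x_j, y_j, z_j) ∈ ρ'; (2) for every function c : {1,…,k} → {1,2,3} there exists j ∈ {1,…,k} such that p_j ∈ ρ, where p_j = (x_j, y_j) if c(j) = 1, p_j = (y_j, z_j) if c(j) = 2, and p_j = (x_j, z_j) if c(j) = 3. (Hence the relation τ_k is definable as the conjunction of the 3^k instances of σ_k obtained by choosing, for each index j, two of the three variables x_j, y_j, z_j.) -/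
/-- ρ := (α×α) ∪ (β×β) ⊆ A². -/
def rho2 {A : Type*} (α β : Set A) : Set (A × A) := (α ×ˢ α) ∪ (β ×ˢ β)

/-- ρ' := (α×α×α) ∪ (β×β×β) ⊆ A³. -/
def rho3 {A : Type*} (α β : Set A) : Set (A × A × A) :=
  (α ×ˢ (α ×ˢ α)) ∪ (β ×ˢ (β ×ˢ β))

/-- For every `c : Fin k → Fin 3`, the pair selected at index `j`:
`(x j, y j)` if `c j = 0`, `(y j, z j)` if `c j = 1`, `(x j, z j)` if `c j = 2`. -/
def selPair {A : Type*} {k : ℕ} (x y z : Fin k → A) (c : Fin k → Fin 3) (j : Fin k) : A × A :=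
  if c j = 0 then (x j, y j) else if c j = 1 then (y j, z j) else (x j, z j)

theorem mem_rho3_iff_pairs_mem_rho2 {A : Type*} {α β : Set A} (hU : α ∪ β = Set.univ)
    (a b c : A) :
    (a, b, c) ∈ rho3 α β ↔
      (a, b) ∈ rho2 α β ∧ (b, c) ∈ rho2 α β ∧ (a, c) ∈ rho2 α β := by
  have h : ∀ t, t ∈ α ∨ t ∈ β := fun t => by
    rw [← Set.mem_union, hU]
    exact Set.mem_univ t
  have ha := h a
  have hb := h b
  have hc := h c
  simp only [rho2, rho3, Set.mem_union, Set.mem_prod]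
  tauto

theorem mem_rho3_iff_forall_selPair_mem_rho2 {A : Type*} {α β : Set A}
    (hU : α ∪ β = Set.univ) {k : ℕ} (x y z : Fin k → A) (j : Fin k) :
    (x j, y j, z j) ∈ rho3 α β ↔
      ∀ i : Fin 3, selPair x y z (fun _ => i) j ∈ rho2 α β := by
  rw [mem_rho3_iff_pairs_mem_rho2 hU, Fin.forall_fin_succ, Fin.forall_fin_two]
  simp [selPair]

theorem statement0 {A : Type*} [Fintype A] (α β : Set A)
    (hα : α ≠ Set.univ) (hβ : β ≠ Set.univ) (hU : α ∪ β = Set.univ)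
    {k : ℕ} (hk : 1 ≤ k) (x y z : Fin k → A) :
    (∃ j : Fin k, (x j, y j, z j) ∈ rho3 α β) ↔
    (∀ c : Fin k → Fin 3, ∃ j : Fin k, selPair x y z c j ∈ rho2 α β) := by
  constructor
  · rintro ⟨j, hj⟩ c
    exact ⟨j, (mem_rho3_iff_forall_selPair_mem_rho2 hU x y z j).1 hj (c j)⟩
  · intro h
    by_contra! hn
    simp only [mem_rho3_iff_forall_selPair_mem_rho2 hU, not_forall] at hn
    choose c hc using hn
    obtain ⟨j, hj⟩ := h c
    exact hc j hj
end

section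
/- Let A be a finite set, m ≥ 1 and Ω ⊆ A^m. If (F_i)_{i∈ℕ} is a decreasing sequence of clones on A and Ω generates A^m with respect to F_i for every i, then Ω generates A^m with respect to the intersection ⋂_i F_i. -/
/-- A finitary operation on `A`, packaged with its arity. -/
abbrev OpA (A : Type*) : Type _ := Σ n : ℕ, (Fin n → A) → A

/-- A clone on `A`: a set of finitary operations containing all projections
and closed under composition. -/
def IsClone {A : Type*} (F : Set (OpA A)) : Prop :=
  (∀ (n : ℕ) (i : Fin n), (⟨n, fun x => x i⟩ : OpA A) ∈ F) ∧
  (∀ (n m : ℕ) (f : (Fin n → A) → A) (g : Fin n → (Fin m → A) → A),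
    (⟨n, f⟩ : OpA A) ∈ F → (∀ i, (⟨m, g i⟩ : OpA A) ∈ F) →
    (⟨m, fun x => f (fun i => g i x)⟩ : OpA A) ∈ F)

/-- `Ω ⊆ A^m` generates `A^m` with respect to a set `F` of operations on `A`:
every `a ∈ A^m` is obtained by applying some `f ∈ F` coordinatewise to tuples from `Ω`. -/
def Generates {A : Type*} {m : ℕ} (Ω : Set (Fin m → A)) (F : Set (OpA A)) : Prop :=
  ∀ a : Fin m → A, ∃ (n : ℕ) (f : (Fin n → A) → A),
    (⟨n, f⟩ : OpA A) ∈ F ∧ ∃ b : Fin n → Fin m → A,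
      (∀ i, b i ∈ Ω) ∧ ∀ j, f (fun i => b i j) = a j

/-- If the finite set `Ω` is enumerated by `e`, then everything generated from `Ω` by a clone is
obtained by applying an operation of arity `|Ω|` to this enumeration. -/
theorem IsClone.exists_apply_enumeration {A : Type*} {m N : ℕ} {Ω : Set (Fin m → A)}
    {F : Set (OpA A)} (hF : IsClone F) (hgen : Generates Ω F) (e : Ω ≃ Fin N) (a : Fin m → A) :
    ∃ g : (Fin N → A) → A, (⟨N, g⟩ : OpA A) ∈ F ∧
      ∀ j, g (fun k => (e.symm k : Fin m → A) j) = a j := by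
  obtain ⟨n, f, hf, b, hb, hfb⟩ := hgen a
  refine ⟨fun x => f fun i => x (e ⟨b i, hb i⟩),
    hF.2 n N f (fun i x => x (e ⟨b i, hb i⟩)) hf fun i => hF.1 N _, fun j => ?_⟩
  simpa using hfb j

theorem statement1 {A : Type*} [Fintype A] {m : ℕ} (hm : 1 ≤ m)
    (Ω : Set (Fin m → A)) (F : ℕ → Set (OpA A))
    (hclone : ∀ i, IsClone (F i))
    (hdec : ∀ i, F (i + 1) ⊆ F i)
    (hgen : ∀ i, Generates Ω (F i)) :
    Generates Ω (⋂ i, F i) := by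
  intro a
  let e := Finite.equivFin Ω
  choose g hgF hga using fun i => (hclone i).exists_apply_enumeration (hgen i) e a
  obtain ⟨f, hf⟩ := Finite.exists_infinite_fiber g
  rw [Set.infinite_coe_iff] at hf
  have hanti : Antitone F := antitone_nat_of_succ_le hdec
  have hfF (i : ℕ) : (⟨_, f⟩ : OpA A) ∈ F i := by
    obtain ⟨k, rfl, hik⟩ := hf.exists_gt i
    exact hanti hik.le (hgF k)
  obtain ⟨k, rfl⟩ := hf.nonempty
  exact ⟨_, g k, Set.mem_iInter.2 hfF, fun l => e.symm l, fun l => (e.symm l).2, hga k⟩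
end

section
/- Let A be a finite set, let α, β be strict subsets of A with α ∪ β = A and α ∩ β ≠ ∅, fix a ∈ α ∩ β and m ≥ 1. Define the (3m+1)-ary operation f on A by: f(x_1,…,x_{3m+1}) = y if at least 3m of the arguments are equal to y, and f(x_1,…,x_{3m+1}) = a otherwise. Then f is a near-unanimity operation (f(x,…,x,y,x,…,x) = x for all x, y ∈ A and every position of y) and f preserves the relation σ_k for every k ≤ m. -/
/-- σ_k ⊆ A^{2k}: the tuples (x₁,y₁,…,x_k,y_k) such that (x_j,y_j) ∈ ρ for some j. -/
def sigmaRel {A : Type*} (α β : Set A) (k : ℕ) : Set (Fin (2 * k) → A) :=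
  {t | ∃ j : Fin k,
    (t ⟨2 * j.1, by have := j.2; omega⟩, t ⟨2 * j.1 + 1, by have := j.2; omega⟩) ∈ rho2 α β}

/-- An n-ary operation `f` preserves an h-ary relation `ρ₀`. -/
def PreservesRel {A : Type*} {n h : ℕ} (f : (Fin n → A) → A) (ρ₀ : Set (Fin h → A)) : Prop :=
  ∀ t : Fin n → Fin h → A, (∀ i, t i ∈ ρ₀) → (fun j => f (fun i => t i j)) ∈ ρ₀

theorem mem_rho2_of_left_mem_inter {A : Type*} {α β : Set A} (hU : α ∪ β = Set.univ)
    {a : A} (ha : a ∈ α ∩ β) (y : A) : (a, y) ∈ rho2 α β := by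
  have hy : y ∈ α ∪ β := hU ▸ Set.mem_univ y
  exact hy.imp (fun h => ⟨ha.1, h⟩) (fun h => ⟨ha.2, h⟩)

theorem mem_rho2_of_right_mem_inter {A : Type*} {α β : Set A} (hU : α ∪ β = Set.univ)
    {a : A} (ha : a ∈ α ∩ β) (y : A) : (y, a) ∈ rho2 α β := by
  have hy : y ∈ α ∪ β := hU ▸ Set.mem_univ y
  exact hy.imp (fun h => ⟨h, ha.1⟩) (fun h => ⟨h, ha.2⟩)

theorem ncard_setOf_eq_add_ncard_setOf_ne {A : Type*} {n : ℕ} (x : Fin n → A) (y : A) :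
    Set.ncard {i | x i = y} + Set.ncard {i | x i ≠ y} = n := by
  have h := Set.ncard_add_ncard_compl {i | x i = y}
  rwa [Nat.card_fin] at h

/-- If every one of `k` sets has at most two elements and `2 * k < n`, then some element of
`Fin n` avoids all of them. -/
theorem exists_forall_notMem_of_ncard_le_two {n k : ℕ} (B : Fin k → Set (Fin n))
    (hB : ∀ j, (B j).ncard ≤ 2) (hk : 2 * k < n) : ∃ i, ∀ j, i ∉ B j := by
  classical
  by_contra! h
  have hcover : (Finset.univ : Finset (Fin n)) ⊆
      Finset.univ.biUnion fun j => (B j).toFinset := fun i _ => by simpa using h i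
  have hle := (Finset.card_le_card hcover).trans
    (Finset.card_biUnion_le_card_mul _ _ 2 fun j _ => by
      rw [← Set.ncard_eq_toFinset_card']; exact hB j)
  simp only [Finset.card_univ, Fintype.card_fin] at hle
  omega

theorem statement2 {A : Type*} [Fintype A] (α β : Set A)
    (hα : α ≠ Set.univ) (hβ : β ≠ Set.univ) (hU : α ∪ β = Set.univ)
    (a : A) (ha : a ∈ α ∩ β) (m : ℕ) (hm : 1 ≤ m)
    (f : (Fin (3 * m + 1) → A) → A)
    (hf1 : ∀ (x : Fin (3 * m + 1) → A) (y : A),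
      3 * m ≤ Set.ncard {i : Fin (3 * m + 1) | x i = y} → f x = y)
    (hf2 : ∀ x : Fin (3 * m + 1) → A,
      (¬ ∃ y : A, 3 * m ≤ Set.ncard {i : Fin (3 * m + 1) | x i = y}) → f x = a) :
    (∀ (x y : A) (i : Fin (3 * m + 1)), f (Function.update (fun _ => x) i y) = x) ∧
    (∀ k : ℕ, 1 ≤ k → k ≤ m → PreservesRel f (sigmaRel α β k)) := by
  constructor
  · intro x y i
    apply hf1
    have hne : {l | Function.update (fun _ => x) i y l ≠ x} ⊆ {i} := by
      intro l hl
      by_contra hli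
      exact hl (Function.update_of_ne hli _ _)
    have hcard := Set.ncard_le_ncard hne
    rw [Set.ncard_singleton] at hcard
    have := ncard_setOf_eq_add_ncard_setOf_ne (Function.update (fun _ => x) i y) x
    omega
  · intro k _ hk t ht
    by_contra hnot
    have few_ne (x : Fin (3 * m + 1) → A) (hx : f x ≠ a) :
        Set.ncard {i | x i ≠ f x} ≤ 1 := by
      obtain ⟨y, hy⟩ := not_imp_comm.1 (hf2 x) hx
      rw [hf1 x y hy]
      have := ncard_setOf_eq_add_ncard_setOf_ne x y
      omega
    let c (l : Fin (2 * k)) : Fin (3 * m + 1) → A := fun i => t i l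
    let p (j : Fin k) : Fin (2 * k) := ⟨2 * j.1, by omega⟩
    let q (j : Fin k) : Fin (2 * k) := ⟨2 * j.1 + 1, by omega⟩
    have hρ (j : Fin k) : (f (c (p j)), f (c (q j))) ∉ rho2 α β := fun h => hnot ⟨j, h⟩
    obtain ⟨i, hi⟩ := exists_forall_notMem_of_ncard_le_two
      (fun j => {i | c (p j) i ≠ f (c (p j))} ∪ {i | c (q j) i ≠ f (c (q j))})
      (fun j => (Set.ncard_union_le _ _).trans <| Nat.add_le_add
        (few_ne (c (p j)) fun h => hρ j (h ▸ mem_rho2_of_left_mem_inter hU ha _))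
        (few_ne (c (q j)) fun h => hρ j (h ▸ mem_rho2_of_right_mem_inter hU ha _)))
      (by omega)
    obtain ⟨j, hj⟩ := ht i
    have hij := hi j
    simp only [Set.mem_union, Set.mem_ofPred_eq, not_or, not_not] at hij
    apply hρ j
    rw [← hij.1, ← hij.2]
    exact hj
end

section
/- Let A be a finite set and let α, β be strict subsets of A with α ∪ β = A. Every αβ-projective operation on A preserves the relation σ_k and the relation τ_k, for every k ≥ 1. -/
/-- τ_k ⊆ A^{3k}: the tuples (x₁,y₁,z₁,…,x_k,y_k,z_k) such that (x_j,y_j,z_j) ∈ ρ' for some j. -/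
def tauRel {A : Type*} (α β : Set A) (k : ℕ) : Set (Fin (3 * k) → A) :=
  {t | ∃ j : Fin k,
    (t ⟨3 * j.1, by have := j.2; omega⟩, t ⟨3 * j.1 + 1, by have := j.2; omega⟩,
      t ⟨3 * j.1 + 2, by have := j.2; omega⟩) ∈ rho3 α β}

/-- An n-ary operation `f` on `A` is αβ-projective. -/
def ABProjective {A : Type*} (α β : Set A) {n : ℕ} (f : (Fin n → A) → A) : Prop :=
  ∃ i : Fin n, ∀ x : Fin n → A, (x i ∈ α → f x ∈ α) ∧ (x i ∈ β → f x ∈ β)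

theorem statement4 {A : Type*} [Fintype A] (α β : Set A)
    (hα : α ≠ Set.univ) (hβ : β ≠ Set.univ) (hU : α ∪ β = Set.univ)
    {n : ℕ} (f : (Fin n → A) → A) (hf : ABProjective α β f)
    (k : ℕ) (hk : 1 ≤ k) :
    PreservesRel f (sigmaRel α β k) ∧ PreservesRel f (tauRel α β k) := by
  obtain ⟨i, hi⟩ := hf
  refine ⟨fun t ht => ?_, fun t ht => ?_⟩
  · obtain ⟨j, hj⟩ := ht i
    refine ⟨j, ?_⟩
    rcases hj with ⟨hx, hy⟩ | ⟨hx, hy⟩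
    · exact Or.inl ⟨(hi _).1 hx, (hi _).1 hy⟩
    · exact Or.inr ⟨(hi _).2 hx, (hi _).2 hy⟩
  · obtain ⟨j, hj⟩ := ht i
    refine ⟨j, ?_⟩
    rcases hj with ⟨hx, hy, hz⟩ | ⟨hx, hy, hz⟩
    · exact Or.inl ⟨(hi _).1 hx, (hi _).1 hy, (hi _).1 hz⟩
    · exact Or.inr ⟨(hi _).2 hx, (hi _).2 hy, (hi _).2 hz⟩
end

section
/- Let A be a finite set, n ≥ 2, and ρ ⊆ Aⁿ an n-ary relation. Then ρ is essential — i.e., there is no family of proper subsets S_j ⊊ {1,…,n} together with relations R_j on the coordinates in S_j such that ρ = {t ∈ Aⁿ : for every j, the restriction of t to S_j lies in R_j} — if and only if there exists an essential tuple for ρ. -/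
/-- A relation `ρ ⊆ Aⁿ` is essential if it cannot be represented as a conjunction
of relations on proper subsets of the coordinates. -/
def IsEssential {A : Type*} {n : ℕ} (ρ : Set (Fin n → A)) : Prop :=
  ¬ ∃ (J : Type) (S : J → Set (Fin n)) (R : ∀ j : J, Set (↥(S j) → A)),
      (∀ j, S j ≠ Set.univ) ∧
      ρ = {t | ∀ j, (fun i : ↥(S j) => t i.1) ∈ R j}

/-- A tuple `a` is essential for `ρ`: `a ∉ ρ` and changing any single coordinate can
bring it into `ρ`. -/
def IsEssentialTuple {A : Type*} {n : ℕ} (ρ : Set (Fin n → A)) (a : Fin n → A) : Prop :=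
  a ∉ ρ ∧ ∀ i : Fin n, ∃ b : A, Function.update a i b ∈ ρ

/-- A relation with an essential tuple is essential. -/
theorem IsEssentialTuple.isEssential {A : Type*} {n : ℕ} {ρ : Set (Fin n → A)} {a : Fin n → A}
    (ha : IsEssentialTuple ρ a) : IsEssential ρ := by
  rintro ⟨J, S, R, hS, rfl⟩
  refine ha.1 fun j => ?_
  obtain ⟨i, hi⟩ := (Set.ne_univ_iff_exists_notMem (S j)).1 (hS j)
  obtain ⟨b, hb⟩ := ha.2 i
  convert hb j using 1
  funext k
  exact (Function.update_of_ne (ne_of_mem_of_not_mem k.2 hi) b a).symm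

/-- An essential relation has an essential tuple: otherwise it would be the conjunction of its
projections along single coordinates. -/
theorem IsEssential.exists_isEssentialTuple {A : Type*} {n : ℕ} {ρ : Set (Fin n → A)}
    (hρ : IsEssential ρ) : ∃ a, IsEssentialTuple ρ a := by
  by_contra! h
  refine hρ ⟨Fin n, fun j => {j}ᶜ, fun j => (fun t i => t i.1) '' ρ, fun j => by simp, ?_⟩
  ext t
  refine ⟨fun ht j => ⟨t, ht, rfl⟩, fun ht => ?_⟩
  by_contra hn
  refine h t ⟨hn, fun j => ?_⟩
  obtain ⟨s, hs, hst⟩ := ht j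
  refine ⟨s j, ?_⟩
  rwa [Function.update_eq_iff.2 ⟨rfl, fun k hk => (congrFun hst ⟨k, hk⟩).symm⟩]

theorem statement5 {A : Type*} [Fintype A] {n : ℕ} (hn : 2 ≤ n)
    (ρ : Set (Fin n → A)) :
    IsEssential ρ ↔ ∃ a : Fin n → A, IsEssentialTuple ρ a :=
  ⟨IsEssential.exists_isEssentialTuple, fun ⟨_, ha⟩ => ha.isEssential⟩
end

section
/- Let f be a k-ary idempotent operation on D = {0,1,2} that preserves the sets {0,2} and {1,2} and satisfies property (*). Then either the set {f, s} is collapsible, or the clone generated by {f, s} contains binary operations p₁ and p₂ such that p₁(0,1) = 1, p₁(1,0) = p₁(2,0) = 2, and p₂(0,1) = 0, p₂(1,0) = p₂(1,2) = 2. -/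
/-- The three-element domain. -/
abbrev D : Type := Fin 3

/-- A finitary operation on `D`, packaged with its arity. -/
abbrev Op : Type := Σ n : ℕ, (Fin n → D) → D

/-- The semilattice-without-unit operation `s`: `s(x,x) = x`, `s(x,y) = 2` for `x ≠ y`. -/
def sFun : (Fin 2 → D) → D := fun x => if x 0 = x 1 then x 0 else 2

/-- `s` as a packaged operation. -/
def sOp : Op := ⟨2, sFun⟩

/-- The clone generated by a set `F` of operations on `D`: the smallest set of
operations containing `F` and all projections and closed under composition. -/
inductive InClone (F : Set Op) : Op → Prop
  | base {g : Op} : g ∈ F → InClone F g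
  | proj {n : ℕ} (i : Fin n) : InClone F ⟨n, fun x => x i⟩
  | comp {n m : ℕ} (f : (Fin n → D) → D) (g : Fin n → (Fin m → D) → D) :
      InClone F ⟨n, f⟩ → (∀ i, InClone F ⟨m, g i⟩) →
      InClone F ⟨m, fun x => f (fun i => g i x)⟩

/-- Closure of a set `S ⊆ D^m` under coordinatewise applications of operations
of the clone generated by `F`. -/
inductive InClosure (F : Set Op) {m : ℕ} (S : Set (Fin m → D)) : (Fin m → D) → Prop
  | base {t : Fin m → D} : t ∈ S → InClosure F S t
  | app {n : ℕ} (f : (Fin n → D) → D) (ts : Fin n → Fin m → D) :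
      InClone F ⟨n, f⟩ → (∀ i, InClosure F S (ts i)) →
      InClosure F S (fun j => f (fun i => ts i j))

/-- `Λ_{m,k}`: the tuples of `D^m` in which at least `m - k` coordinates are equal. -/
def Lam (m k : ℕ) : Set (Fin m → D) :=
  {x | ∃ a : D, m - k ≤ Set.ncard {i : Fin m | x i = a}}

/-- `F` is `k`-collapsible. -/
def KCollapsible (F : Set Op) (k : ℕ) : Prop :=
  ∀ m : ℕ, 1 ≤ m → ∀ t : Fin m → D, InClosure F (Lam m k) t

/-- `F` is collapsible: `k`-collapsible for some `k`. -/
def Collapsible (F : Set Op) : Prop := ∃ k, KCollapsible F k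

/-- An operation is idempotent. -/
def Idem {n : ℕ} (g : (Fin n → D) → D) : Prop := ∀ x : D, g (fun _ => x) = x

/-- An operation preserves a subset `B ⊆ D`. -/
def PreservesSet {n : ℕ} (g : (Fin n → D) → D) (B : Set D) : Prop :=
  ∀ x : Fin n → D, (∀ i, x i ∈ B) → g x ∈ B

/-- A tuple lies in `{0,1}^n`. -/
def Bool01 {n : ℕ} (x : Fin n → D) : Prop := ∀ j, x j = 0 ∨ x j = 1

/-- Property (*): for each coordinate `i` there is `x ∈ {0,1}^k` with
`f(x) ∈ {0,1}` and `f(x) ≠ x_i`. -/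
def PropStar {k : ℕ} (f : (Fin k → D) → D) : Prop :=
  ∀ i : Fin k, ∃ x : Fin k → D, Bool01 x ∧ (f x = 0 ∨ f x = 1) ∧ f x ≠ x i

/-- Class (i): coordinates with a `0 ↦ 1` witness but no `1 ↦ 0` witness. -/
def ClassI {k : ℕ} (f : (Fin k → D) → D) : Set (Fin k) :=
  {i | (∃ x, Bool01 x ∧ x i = 0 ∧ f x = 1) ∧ ¬ ∃ x, Bool01 x ∧ x i = 1 ∧ f x = 0}

/-- Class (ii): coordinates with a `1 ↦ 0` witness but no `0 ↦ 1` witness. -/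
def ClassII {k : ℕ} (f : (Fin k → D) → D) : Set (Fin k) :=
  {i | (∃ x, Bool01 x ∧ x i = 1 ∧ f x = 0) ∧ ¬ ∃ x, Bool01 x ∧ x i = 0 ∧ f x = 1}

theorem mem_Lam_of_card_le {m K : ℕ} (x : Fin m → D) (b : D)
    (h : (Finset.univ.filter fun i => x i ≠ b).card ≤ K) : x ∈ Lam m K := by
  refine ⟨b, ?_⟩
  have h1 : {i : Fin m | x i = b} = ↑(Finset.univ.filter fun i => x i = b) := by
    ext i; simp
  have h2 := Finset.card_filter_add_card_filter_not (s := (Finset.univ : Finset (Fin m)))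
    (fun i => x i = b)
  rw [h1, Set.ncard_coe_finset]
  simp only [Finset.card_univ, Fintype.card_fin] at h2
  simp only [ne_eq] at h
  omega

theorem InClosure.sFun_app {F : Set Op} (hs : sOp ∈ F) {m : ℕ} {S : Set (Fin m → D)}
    {u v : Fin m → D} (hu : InClosure F S u) (hv : InClosure F S v) :
    InClosure F S (fun j => if u j = v j then u j else 2) :=
  InClosure.app sFun ![u, v] (InClone.base hs) (by
    intro i
    fin_cases i
    · exact hu
    · exact hv)

theorem exists_ne_and_ne_two (a : D) : ∃ b : D, b ≠ a ∧ b ≠ 2 := by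
  revert a; decide

/-- Tuples with at most `k` coordinates equal to `a` are generated using `s` alone. -/
theorem inClosure_of_card_le {F : Set Op} (hs : sOp ∈ F) {m k : ℕ} {a : D} (ha : a ≠ 2)
    (t : Fin m → D) (ht : (Finset.univ.filter fun i => t i = a).card ≤ k) :
    InClosure F (Lam m (k + 1)) t := by
  obtain ⟨b, hba, hb2⟩ := exists_ne_and_ne_two a
  have key : ∀ C : Finset (Fin m), (∀ c ∈ C, t c = 2) →
      InClosure F (Lam m (k + 1))
        (fun j => if j ∈ C then 2 else if t j = a then a else b) := by
    intro C
    induction C using Finset.induction_on with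
    | empty =>
      intro _
      refine InClosure.base (mem_Lam_of_card_le _ b (le_trans (Finset.card_le_card ?_)
        (ht.trans (Nat.le_succ k))))
      intro i
      simp only [Finset.mem_filter, Finset.mem_univ, true_and]
      grind
    | insert c C hc ih =>
      intro hC
      have hv : InClosure F (Lam m (k + 1))
          (fun j => if j = c then 2 else if t j = a then a else b) := by
        refine InClosure.base (mem_Lam_of_card_le _ b (le_trans
          (Finset.card_le_card (t := insert c (Finset.univ.filter fun i => t i = a)) ?_)
          ((Finset.card_insert_le _ _).trans (Nat.succ_le_succ ht))))
        intro i
        simp only [Finset.mem_filter, Finset.mem_univ, true_and, Finset.mem_insert]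
        grind
      have := (ih fun x hx => hC x (Finset.mem_insert_of_mem hx)).sFun_app hs hv
      convert this using 2 with j
      have hc2 := hC c (Finset.mem_insert_self c C)
      have hC2 : j ∈ C → t j = 2 := fun h => hC j (Finset.mem_insert_of_mem h)
      simp only [Finset.mem_insert]
      grind
  have h := key (Finset.univ.filter fun i => t i = 2) (by simp)
  convert h using 2 with j
  have hcases : ∀ a b x : D, a ≠ 2 → b ≠ a → b ≠ 2 → x ≠ 2 → x ≠ a → x = b := by decide
  have := hcases a b (t j) ha hba hb2
  simp only [Finset.mem_filter, Finset.mem_univ, true_and]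
  grind

/-- If no coordinate of `f` is forced to be `a` by the value `a`, then `{f, s}` is collapsible. -/
theorem collapsible_of_forall_exists_ne {k : ℕ} {f : (Fin k → D) → D} (hidem : Idem f)
    {a : D} (ha : a ≠ 2) (h : ∀ l, ∃ c : Fin k → D, f c = a ∧ c l ≠ a) :
    Collapsible {⟨k, f⟩, sOp} := by
  choose c hc hcl using h
  refine ⟨k + 1, fun m _ t => ?_⟩
  induction hn : (Finset.univ.filter fun i => t i = a).card using Nat.strong_induction_on
    generalizing t with
  | _ n ih =>
    by_cases hle : n ≤ k
    · exact inClosure_of_card_le (by simp) ha t (hn ▸ hle)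
    · obtain ⟨e⟩ : Nonempty (Fin k ↪ (Finset.univ.filter fun i => t i = a)) :=
        Function.Embedding.nonempty_of_card_le (by
          simp only [Fintype.card_fin, Fintype.card_coe]
          omega)
      have he : ∀ l, t (e l) = a := fun l => (Finset.mem_filter.1 (e l).2).2
      classical
      let col : Fin m → Fin k → D := fun j =>
        if hj : ∃ l, (e l : Fin m) = j then c hj.choose else fun _ => t j
      have hcol : ∀ l, col (e l) = c l := by
        intro l
        have hj : ∃ l', (e l' : Fin m) = e l := ⟨l, rfl⟩
        have : hj.choose = l := e.injective (Subtype.ext hj.choose_spec)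
        simp only [col, dif_pos hj, this]
      have hcol' : ∀ j, (¬ ∃ l, (e l : Fin m) = j) → col j = fun _ => t j := by
        intro j hj
        simp only [col, dif_neg hj]
      have hrow : ∀ l, InClosure {⟨k, f⟩, sOp} (Lam m (k + 1)) (fun j => col j l) := by
        intro l
        refine ih _ ?_ _ rfl
        rw [← hn]
        refine Finset.card_lt_card (Finset.ssubset_iff_of_subset ?_ |>.2 ⟨e l, (e l).2, ?_⟩)
        · intro j
          simp only [Finset.mem_filter, Finset.mem_univ, true_and]
          by_cases hj : ∃ l, (e l : Fin m) = j
          · obtain ⟨l', rfl⟩ := hj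
            exact fun _ => he l'
          · rw [hcol' j hj]
            exact id
        · simp [hcol, hcl]
      have happ := InClosure.app f (fun l j => col j l) (InClone.base (by simp)) hrow
      convert happ using 2 with j
      by_cases hj : ∃ l, (e l : Fin m) = j
      · obtain ⟨l', rfl⟩ := hj
        rw [he]
        exact ((congrArg f (hcol l')).trans (hc l')).symm
      · exact ((congrArg f (hcol' j hj)).trans (hidem (t j))).symm

/-- Substituting one of two variables into each argument of `f` stays in the clone. -/
theorem inClone_substitution {F : Set Op} {k : ℕ} {f : (Fin k → D) → D}
    (hf : (⟨k, f⟩ : Op) ∈ F) (σ : Fin k → Fin 2) :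
    InClone F ⟨2, fun x => f fun i => x (σ i)⟩ :=
  InClone.comp f (fun i x => x (σ i)) (InClone.base hf) fun i => InClone.proj (σ i)

theorem exists_binary {k : ℕ} {f : (Fin k → D) → D} {F : Set Op} (hf : (⟨k, f⟩ : Op) ∈ F)
    {a b : D} (hab : a ≠ b) (ha : a ≠ 2) (hb : b ≠ 2)
    (hpres : PreservesSet f {a, 2}) {w : Fin k → D} (hw : ∀ i, w i = a ∨ w i = b)
    (hfw : f w = b) {l l' : Fin k} (hl : ∀ c, f c = a → c l = a) (hl' : ∀ c, f c = b → c l' = b)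
    (hwl : w l = a) :
    ∃ σ : Fin k → Fin 2, InClone F ⟨2, fun x => f fun i => x (σ i)⟩ ∧
      (f fun i => ![a, b] (σ i)) = b ∧ (f fun i => ![b, a] (σ i)) = 2 ∧
      (f fun i => ![2, a] (σ i)) = 2 := by
  have hwl' := hl' w hfw
  refine ⟨fun i => if w i = a then 0 else 1, inClone_substitution hf _, ?_, ?_, ?_⟩
  · rw [← hfw]
    congr 1
    funext i
    rw [hfw]
    rcases hw i with h | h <;> simp [h, hab.symm]
  · have hcases : ∀ a b x : D, a ≠ b → a ≠ 2 → b ≠ 2 → x ≠ a → x ≠ b → x = 2 := by decide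
    refine hcases a b _ hab ha hb (fun h => ?_) (fun h => ?_)
    · have := hl _ h
      simp [hwl, hab.symm] at this
    · have := hl' _ h
      simp [hwl', hab.symm, hab] at this
  · have hmem := hpres (fun i => ![2, a] (if w i = a then 0 else 1)) (by
      intro i
      by_cases h : w i = a <;> simp [h])
    rcases hmem with h | h
    · have := hl _ h
      simp [hwl, ha.symm] at this
    · exact h

theorem statement7 {k : ℕ} (f : (Fin k → D) → D)
    (hidem : Idem f)
    (h02 : PreservesSet f {0, 2}) (h12 : PreservesSet f {1, 2})
    (hstar : PropStar f) :
    Collapsible {⟨k, f⟩, sOp} ∨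
    ∃ p₁ p₂ : (Fin 2 → D) → D,
      InClone {⟨k, f⟩, sOp} ⟨2, p₁⟩ ∧ InClone {⟨k, f⟩, sOp} ⟨2, p₂⟩ ∧
      p₁ ![0, 1] = 1 ∧ p₁ ![1, 0] = 2 ∧ p₁ ![2, 0] = 2 ∧
      p₂ ![0, 1] = 0 ∧ p₂ ![1, 0] = 2 ∧ p₂ ![1, 2] = 2 := by
  by_cases h0 : ∀ l, ∃ c : Fin k → D, f c = 0 ∧ c l ≠ 0
  · exact Or.inl (collapsible_of_forall_exists_ne hidem (by decide) h0)
  by_cases h1 : ∀ l, ∃ c : Fin k → D, f c = 1 ∧ c l ≠ 1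
  · exact Or.inl (collapsible_of_forall_exists_ne hidem (by decide) h1)
  push Not at h0 h1
  obtain ⟨i, hi⟩ := h0
  obtain ⟨j, hj⟩ := h1
  right
  obtain ⟨w, hw, hfw, hwi⟩ := hstar i
  obtain ⟨v, hv, hfv, hvj⟩ := hstar j
  have hfw1 : f w = 1 := hfw.resolve_left fun h => hwi (by rw [h, hi w h])
  have hfv0 : f v = 0 := hfv.resolve_right fun h => hvj (by rw [h, hj v h])
  have hwi0 : w i = 0 := (hw i).resolve_right fun h => hwi (by rw [h, hfw1])
  have hvj1 : v j = 1 := (hv j).resolve_left fun h => hvj (by rw [h, hfv0])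
  obtain ⟨σ, hσ, hσ1, hσ2, hσ3⟩ := exists_binary (F := {⟨k, f⟩, sOp}) (by simp)
    (by decide) (by decide) (by decide) h02 hw hfw1 hi hj hwi0
  obtain ⟨τ, -, hτ1, hτ2, hτ3⟩ := exists_binary (F := {⟨k, f⟩, sOp}) (by simp)
    (by decide) (by decide) (by decide) h12 (fun i => (hv i).symm) hfv0 hj hi hvj1
  have hrev : ∀ (x y : D) (u : Fin 2), ![x, y] (Fin.rev u) = ![y, x] u := by decide
  refine ⟨_, _, hσ, inClone_substitution (f := f) (by simp) fun l => (τ l).rev,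
    hσ1, hσ2, hσ3, ?_, ?_, ?_⟩
  · simpa only [hrev] using hτ1
  · simpa only [hrev] using hτ2
  · simpa only [hrev] using hτ3
end

section
/- Let f be a k-ary idempotent operation on D = {0,1,2} that preserves {0,2} and {1,2} and satisfies property (*), such that Class (i) consists of a single coordinate i₀ and there exists a tuple x ∈ {0,1}^k with x_{i₀} = 0 and x_j = 1 for every j in Class (ii) such that f(x) = 1. Then either the clone generated by {f, s} contains a binary idempotent operation q with q(0,1) = 0 and q(0,2) = 2, or the set {f, s} is collapsible. -/
/-- A tuple in which at most `k` entries lie outside `{c, 2}` is generated by the tuples of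
`Lam m (k + 1)` with the help of `s`. -/
theorem inClosure_of_ncard_le {F : Set Op} (hs : InClone F sOp) {m k : ℕ} (c : D)
    (t : Fin m → D) (ht : Set.ncard {u | t u ≠ c ∧ t u ≠ 2} ≤ k) :
    InClosure F (Lam m (k + 1)) t := by
  rcases eq_or_ne c 2 with rfl | hc
  · refine .base ⟨2, ?_⟩
    have h := Set.ncard_add_ncard_compl {u | t u = 2}
    have h' : {u | t u = 2}ᶜ = {u | t u ≠ 2 ∧ t u ≠ 2} := by ext; simp
    rw [h', Nat.card_fin] at h
    omega
  induction hn : Set.ncard {u | t u = 2} using Nat.strong_induction_on generalizing t with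
  | _ n ih =>
  have almostConst : ∀ r : Fin m → D, Set.ncard {u | r u ≠ c} ≤ k + 1 →
      InClosure F (Lam m (k + 1)) r := fun r hr => by
    refine .base ⟨c, ?_⟩
    have h := Set.ncard_add_ncard_compl {u | r u = c}
    have h' : {u | r u = c}ᶜ = {u | r u ≠ c} := rfl
    rw [h', Nat.card_fin] at h
    omega
  by_cases h2 : ∃ u, t u = 2
  · obtain ⟨u, hu⟩ := h2
    have h₁ : InClosure F (Lam m (k + 1)) (Function.update t u c) := by
      refine ih _ ?_ _ (le_trans (Set.ncard_le_ncard ?_) ht) rfl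
      · rw [← hn]
        refine Set.ncard_lt_ncard ⟨?_, fun h => ?_⟩
        · intro v hv
          by_cases hvu : v = u <;> simp_all [Function.update_apply]
        · have := h hu
          simp_all
      · intro v hv
        by_cases hvu : v = u <;> simp_all [Function.update_apply]
    have h₂ : InClosure F (Lam m (k + 1))
        (Function.update (fun v => if t v = 2 then c else t v) u 2) := by
      refine almostConst _ ?_
      calc _ ≤ Set.ncard (insert u {v | t v ≠ c ∧ t v ≠ 2}) := by
            refine Set.ncard_le_ncard fun v hv => ?_
            by_cases hvu : v = u
            · exact Or.inl hvu
            · by_cases hv2 : t v = 2 <;> simp_all [Function.update_apply]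
        _ ≤ _ := (Set.ncard_insert_le _ _).trans (by omega)
    have h := InClosure.app (S := Lam m (k + 1)) sFun
      ![Function.update t u c, Function.update (fun v => if t v = 2 then c else t v) u 2] hs
      (fun i => by fin_cases i <;> assumption)
    convert h using 1
    ext v : 1
    by_cases hvu : v = u
    · subst hvu
      simp [sFun, hu, hc]
    · by_cases hv2 : t v = 2
      · simp [sFun, hvu, hv2, hc.symm]
      · simp [sFun, hvu, hv2]
  · refine almostConst t (le_trans (Set.ncard_le_ncard fun v hv => ?_) (ht.trans k.le_succ))
    exact ⟨hv, fun h => h2 ⟨v, h⟩⟩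

theorem eq_one_of_ne {a : D} (h₀ : a ≠ 0) (h₂ : a ≠ 2) : a = 1 := by
  revert a
  decide

/-- Weights that make the tuples fed to `f` in `kCollapsible_of_witnesses` smaller than the
tuple they produce. -/
def weight : D → ℕ := ![1, 2, 0]

/-- An idempotent `f` is collapsible together with `s` if some coordinate `i₀` admits a
`0 ↦ 1` witness, and every other coordinate `j` admits a tuple in `{0,2}^k` that is `2` at `j`
and is sent to `0`. -/
theorem kCollapsible_of_witnesses {F : Set Op} {k : ℕ} {f : (Fin k → D) → D}
    (hf : InClone F ⟨k, f⟩) (hs : InClone F sOp) (hidem : Idem f) (i₀ : Fin k)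
    {x : Fin k → D} (hx : Bool01 x) (hx₀ : x i₀ = 0) (hfx : f x = 1)
    {Y : Fin k → Fin k → D} (hY : ∀ j i, Y j i = 0 ∨ Y j i = 2)
    (hYd : ∀ j, j ≠ i₀ → Y j j = 2) (hfY : ∀ j, f (Y j) = 0) :
    KCollapsible F (k + 1) := by
  intro m _ t
  induction hn : ∑ u, weight (t u) using Nat.strong_induction_on generalizing t with
  | _ n ih =>
  by_cases h1 : ∃ o, t o = 1
  swap
  · refine inClosure_of_ncard_le hs 0 t (le_of_eq_of_le ?_ k.zero_le)
    rw [Set.ncard_eq_zero, Set.eq_empty_iff_forall_notMem]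
    rintro u ⟨hu0, hu2⟩
    exact h1 ⟨u, eq_one_of_ne hu0 hu2⟩
  obtain ⟨o, ho⟩ := h1
  by_cases hk : Set.ncard {u | t u ≠ 1 ∧ t u ≠ 2} ≤ k
  · exact inClosure_of_ncard_le hs 1 t hk
  obtain ⟨e⟩ : Nonempty (Fin k ↪ {u | t u ≠ 1 ∧ t u ≠ 2}) := by
    classical
    refine Function.Embedding.nonempty_of_card_le ?_
    rw [Fintype.card_fin, ← Nat.card_eq_fintype_card]
    exact (not_le.mp hk).le
  have hinj : Function.Injective fun j => (e j : Fin m) := Subtype.val_injective.comp e.injective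
  have he : ∀ j, t (e j) = 0 := fun j => by
    by_contra h
    exact (e j).2.1 (eq_one_of_ne h (e j).2.2)
  have heo : ∀ j, (e j : Fin m) ≠ o := fun j h => by
    have := he j
    rw [h, ho] at this
    exact absurd this (by decide)
  let ts : Fin k → Fin m → D := fun i =>
    Function.update (Function.extend (fun j => (e j : Fin m)) (fun j => Y j i) t) o (x i)
  have hts_o : ∀ i, ts i o = x i := fun i => by simp [ts]
  have hts_e : ∀ i j, ts i (e j) = Y j i := fun i j => by
    simp only [ts, Function.update_of_ne (heo j)]
    exact hinj.extend_apply _ _ j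
  have hts : ∀ i u, u ≠ o → (¬ ∃ j, (e j : Fin m) = u) → ts i u = t u := fun i u hu hu' => by
    simp only [ts, Function.update_of_ne hu]
    exact Function.extend_apply' _ _ _ hu'
  have hout : (fun u => f fun i => ts i u) = t := by
    ext u : 1
    by_cases hu : u = o
    · subst hu
      simp only [hts_o, ho]
      exact hfx
    by_cases hu' : ∃ j, (e j : Fin m) = u
    · obtain ⟨j, rfl⟩ := hu'
      simp only [hts_e, he]
      exact hfY j
    · simp only [hts _ u hu hu']
      exact hidem _
  rw [← hout]
  refine InClosure.app f ts hf fun i => ih _ ?_ _ rfl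
  rw [← hn]
  refine Finset.sum_lt_sum (fun u _ => ?_) ?_
  · by_cases hu : u = o
    · subst hu
      rw [hts_o, ho]
      rcases hx i with h | h <;> simp [h, weight]
    by_cases hu' : ∃ j, (e j : Fin m) = u
    · obtain ⟨j, rfl⟩ := hu'
      rw [hts_e, he]
      rcases hY j i with h | h <;> simp [h, weight]
    · rw [hts i u hu hu']
  · by_cases hi : i = i₀
    · refine ⟨o, Finset.mem_univ _, ?_⟩
      rw [hts_o, ho, hi, hx₀]
      decide
    · refine ⟨e i, Finset.mem_univ _, ?_⟩
      rw [hts_e, he, hYd i hi]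
      decide

theorem statement8 {k : ℕ} (f : (Fin k → D) → D)
    (hidem : Idem f)
    (h02 : PreservesSet f {0, 2}) (h12 : PreservesSet f {1, 2})
    (hstar : PropStar f)
    (i₀ : Fin k) (hI : ClassI f = {i₀})
    (hx : ∃ x : Fin k → D, Bool01 x ∧ x i₀ = 0 ∧ (∀ j ∈ ClassII f, x j = 1) ∧ f x = 1) :
    (∃ q : (Fin 2 → D) → D, InClone {⟨k, f⟩, sOp} ⟨2, q⟩ ∧ Idem q ∧
      q ![0, 1] = 0 ∧ q ![0, 2] = 2) ∨
    Collapsible {⟨k, f⟩, sOp} := by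
  classical
  obtain ⟨x, hx, hx₀, -, hfx⟩ := hx
  refine or_iff_not_imp_left.mpr fun hq => ⟨k + 1, ?_⟩
  have hf : InClone {⟨k, f⟩, sOp} ⟨k, f⟩ := .base (Or.inl rfl)
  have key : ∀ y : Fin k → D, Bool01 y → f y = 0 → f (fun i => if y i = 0 then 0 else 2) = 0 := by
    intro y hy hfy
    by_contra hne
    refine hq ⟨fun a => f fun i => a (if y i = 0 then 0 else 1),
      .comp f (fun i a => a (if y i = 0 then 0 else 1)) hf fun i => .proj _,
      fun a => hidem a, ?_, ?_⟩
    · refine Eq.trans (congrArg f (funext fun i => ?_)) hfy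
      rcases hy i with h | h <;> simp [h]
    · have hY : (fun i => (![0, 2] : Fin 2 → D) (if y i = 0 then 0 else 1)) =
          fun i => if y i = 0 then 0 else 2 := by
        ext i : 1
        split_ifs <;> rfl
      simp only [hY]
      refine (h02 _ fun i => ?_).resolve_left hne
      split_ifs <;> simp
  have hwit : ∀ j, ∃ y : Fin k → D, Bool01 y ∧ f y = 0 ∧ (j ≠ i₀ → y j = 1) := by
    intro j
    by_cases hj : j = i₀
    · exact ⟨fun _ => 0, fun _ => Or.inl rfl, hidem 0, fun h => absurd hj h⟩
    have hjI : j ∉ ClassI f := by rwa [hI]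
    have down : ∃ y, Bool01 y ∧ y j = 1 ∧ f y = 0 := by
      obtain ⟨y, hy, hfy, hne⟩ := hstar j
      by_contra hno
      refine hjI ⟨⟨y, hy, ?_⟩, hno⟩
      rcases hy j with h | h <;> rcases hfy with h' | h'
      · exact absurd (h'.trans h.symm) hne
      · exact ⟨h, h'⟩
      · exact absurd ⟨y, hy, h, h'⟩ hno
      · exact absurd (h'.trans h.symm) hne
    obtain ⟨y, hy, hyj, hfy⟩ := down
    exact ⟨y, hy, hfy, fun _ => hyj⟩
  choose y hy hfy hyj using hwit
  refine kCollapsible_of_witnesses (Y := fun j i => if y j i = 0 then 0 else 2) hf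
    (.base (Or.inr rfl)) hidem i₀ hx hx₀ hfx (fun j i => ?_) (fun j hj => ?_)
    fun j => key _ (hy j) (hfy j)
  · by_cases h : y j i = 0 <;> simp [h]
  · simp [hyj j hj]
end

section
/- Let f be a k-ary idempotent operation on D = {0,1,2} that preserves {0,2} and {1,2} and satisfies property (*), such that Class (i) consists of a single coordinate i₀ and there exists a tuple x ∈ {0,1}^k with x_{i₀} = 0 and x_j = 1 for every j in Class (ii) such that f(x) = 1. Then either the set {f, s} is collapsible, or the clone generated by {f, s} contains a 4-ary operation r₄ with r₄(0,1,0,1) = 0, r₄(0,1,1,0) = 0 and r₄(0,1,1,1) = 2. -/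
/-- A tuple all but `k` of whose entries equal `b` lies in `Λ_{m,k}`. -/
theorem mem_Lam_of_ncard_ne_le {m k : ℕ} {t : Fin m → D} (b : D)
    (h : {j | t j ≠ b}.ncard ≤ k) : t ∈ Lam m k := by
  refine ⟨b, ?_⟩
  have hc := Set.ncard_add_ncard_compl {j | t j = b}
  have he : {j | t j = b}ᶜ = {j | t j ≠ b} := rfl
  rw [he, Nat.card_fin] at hc
  omega

/-- With the operation `s` at hand, collapsibility only has to be checked on `{0,1}`-tuples. -/
theorem kCollapsible_of_bool01 {F : Set Op} (hs : sOp ∈ F) {k : ℕ}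
    (h : ∀ (m : ℕ) (t : Fin m → D), Bool01 t → InClosure F (Lam m k) t) :
    KCollapsible F k := by
  intro m _ t
  let u : Fin 2 → Fin m → D := fun a j => if t j = 2 then (if a = 0 then 0 else 1) else t j
  have hu : ∀ a, Bool01 (u a) := by
    intro a j
    simp only [u]
    generalize t j = z
    revert a z
    decide
  have hst : (fun j => sFun (fun a => u a j)) = t := by
    funext j
    simp only [u, sFun]
    generalize t j = z
    revert z
    decide
  rw [← hst]
  exact InClosure.app sFun u (InClone.base hs) fun a => h m _ (hu a)

/-- If `x` and the tuples of a family `Y` of size at most `N` are mapped to `b` and `a ≠ b`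
respectively, and every entry of `x` is matched by some member of `Y`, then a tuple with more
than `N` entries `a` and all other entries `b` is the image under `f` of tuples that are closer
to being constant. -/
theorem exists_rows {k m : ℕ} {f : (Fin k → D) → D} {a b : D} {t : Fin m → D}
    (ht : ∀ j, t j = b ∨ t j = a) {x : Fin k → D} (hx : Bool01 x) (hfx : f x = b)
    (hxY : ∀ i, ∃ y, Bool01 y ∧ f y = a ∧ y i = x i)
    (hY : ∃ y, Bool01 y ∧ f y = a)
    (hN : Nat.card (Fin k → D) < {j | t j ≠ b}.ncard) :
    ∃ rows : Fin k → Fin m → D, (∀ i, Bool01 (rows i)) ∧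
      (∀ i, {j | rows i j ≠ x i}.ncard < {j | t j ≠ b}.ncard) ∧
      (fun j => f (fun i => rows i j)) = t := by
  classical
  obtain ⟨y₀, hy₀, hfy₀⟩ := hY
  let Y := {y : Fin k → D // Bool01 y ∧ f y = a}
  have hcard : Fintype.card Y ≤ Fintype.card {j // t j ≠ b} := by
    have h1 : Fintype.card Y ≤ Fintype.card (Fin k → D) := Fintype.card_subtype_le _
    have h2 : {j | t j ≠ b}.ncard = Fintype.card {j // t j ≠ b} := by
      rw [← Nat.card_coe_set_eq, Nat.card_eq_fintype_card]
      rfl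
    rw [Nat.card_eq_fintype_card] at hN
    omega
  obtain ⟨e⟩ := Function.Embedding.nonempty_of_card_le hcard
  have hinj : Function.Injective (fun y : Y => (e y).1) :=
    Subtype.val_injective.comp e.injective
  let φ : Fin m → Y := Function.extend (fun y : Y => (e y).1) id (fun _ => ⟨y₀, hy₀, hfy₀⟩)
  have hφ : ∀ y : Y, φ (e y).1 = y := fun y => hinj.extend_apply id _ y
  refine ⟨fun i j => if t j = b then x i else (φ j).1 i, ?_, ?_, ?_⟩
  · intro i j
    dsimp only
    split_ifs
    · exact hx i
    · exact (φ j).2.1 i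
  · intro i
    obtain ⟨y, hy, hfy, hyi⟩ := hxY i
    refine Set.ncard_lt_ncard ?_ (Set.toFinite _)
    refine (Set.ssubset_iff_of_subset ?_).2 ⟨(e ⟨y, hy, hfy⟩).1, (e ⟨y, hy, hfy⟩).2, ?_⟩
    · intro j hj hb
      simp [hb] at hj
    · simp only [Set.mem_ofPred_eq, not_not, hφ, hyi, ite_self]
  · funext j
    by_cases hj : t j = b
    · simp only [hj, if_true]
      exact hfx
    · simp only [hj, if_false]
      rw [(ht j).resolve_left hj]
      exact (φ j).2.2

/-- If for both orderings `{a, b} = {0, 1}` there is a tuple with value `b` each of whose entries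
is matched by a tuple with value `a`, then the operation together with `s` is collapsible. -/
theorem collapsible_of_matching {k : ℕ} {f : (Fin k → D) → D} (hidem : Idem f)
    (h10 : ∃ x, Bool01 x ∧ f x = 1 ∧ ∀ i, ∃ y, Bool01 y ∧ f y = 0 ∧ y i = x i)
    (h01 : ∃ y, Bool01 y ∧ f y = 0 ∧ ∀ i, ∃ x, Bool01 x ∧ f x = 1 ∧ x i = y i) :
    Collapsible {⟨k, f⟩, sOp} := by
  refine ⟨Nat.card (Fin k → D), kCollapsible_of_bool01 (by simp) fun m t ht => ?_⟩
  suffices H : ∀ (n : ℕ) (t : Fin m → D) (b : D), Bool01 t → (b = 0 ∨ b = 1) →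
      {j | t j ≠ b}.ncard = n →
      InClosure {⟨k, f⟩, sOp} (Lam m (Nat.card (Fin k → D))) t from
    H _ t 0 ht (Or.inl rfl) rfl
  intro n
  induction n using Nat.strong_induction_on with
  | _ n ih =>
    intro t b ht hb hn
    by_cases hN : {j | t j ≠ b}.ncard ≤ Nat.card (Fin k → D)
    · exact InClosure.base (mem_Lam_of_ncard_ne_le b hN)
    push Not at hN
    have hstep : ∃ (x : Fin k → D) (rows : Fin k → Fin m → D), Bool01 x ∧
        (∀ i, Bool01 (rows i)) ∧
        (∀ i, {j | rows i j ≠ x i}.ncard < {j | t j ≠ b}.ncard) ∧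
        (fun j => f (fun i => rows i j)) = t := by
      rcases hb with rfl | rfl
      · obtain ⟨y, hy, hfy, hyX⟩ := h01
        exact ⟨y, (exists_rows ht hy hfy hyX ⟨_, fun _ => Or.inr rfl, hidem 1⟩ hN).imp
          fun _ h => ⟨hy, h⟩⟩
      · obtain ⟨x, hx, hfx, hxY⟩ := h10
        exact ⟨x, (exists_rows (fun j => (ht j).symm) hx hfx hxY
          ⟨_, fun _ => Or.inl rfl, hidem 0⟩ hN).imp fun _ h => ⟨hx, h⟩⟩
    obtain ⟨x, rows, hx, hrows, hlt, hf⟩ := hstep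
    rw [← hf]
    exact InClosure.app f rows (InClone.base (by simp)) fun i =>
      ih _ (hn ▸ hlt i) (rows i) (x i) (hrows i) (hx i) rfl

/-- The coordinatewise maximum of two `{0,1}`-tuples. -/
def bjoin {k : ℕ} (y z : Fin k → D) : Fin k → D := fun i => if y i = 0 then z i else y i

theorem bool01_bjoin {k : ℕ} {y z : Fin k → D} (hy : Bool01 y) (hz : Bool01 z) :
    Bool01 (bjoin y z) := by
  intro i
  unfold bjoin
  split_ifs
  · exact hz i
  · exact hy i

/-- If `f y = f z = 0` and `f (y ∨ z) = 1`, then `f` acts as a conjunction and all tuples are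
generated from those with at most one deviating entry. -/
theorem collapsible_of_bjoin {k : ℕ} {f : (Fin k → D) → D} {y z : Fin k → D}
    (hy : Bool01 y) (hz : Bool01 z) (hfy : f y = 0) (hfz : f z = 0) (hfj : f (bjoin y z) = 1) :
    Collapsible {⟨k, f⟩, sOp} := by
  refine ⟨1, kCollapsible_of_bool01 (by simp) fun m t ht => ?_⟩
  induction hn : {j | t j ≠ 1}.ncard using Nat.strong_induction_on generalizing t with
  | _ n ih =>
    by_cases hN : {j | t j ≠ 1}.ncard ≤ 1
    · exact InClosure.base (mem_Lam_of_ncard_ne_le 1 hN)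
    push Not at hN
    obtain ⟨p, hp, q, hq, hpq⟩ := (Set.one_lt_ncard (Set.toFinite _)).1 hN
    let rows : Fin k → Fin m → D := fun i j =>
      if t j = 1 then bjoin y z i else if j = p then y i else z i
    have hf : (fun j => f (fun i => rows i j)) = t := by
      funext j
      by_cases hj : t j = 1
      · simp only [rows, hj, if_true]
        exact hfj
      · rw [(ht j).resolve_right hj]
        by_cases hjp : j = p
        · simp only [rows, hjp ▸ hj, if_false, hjp, if_true]
          exact hfy
        · simp only [rows, hj, if_false, hjp]
          exact hfz
    rw [← hf]
    refine InClosure.app f rows (InClone.base (by simp)) fun i => ?_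
    have hrows : Bool01 (rows i) := by
      intro j
      simp only [rows]
      split_ifs
      · exact bool01_bjoin hy hz i
      · exact hy i
      · exact hz i
    by_cases hyz : y i = 0 ∧ z i = 0
    · refine InClosure.base (mem_Lam_of_ncard_ne_le 0 ?_)
      have : {j | rows i j ≠ 0} = ∅ := by
        ext j
        simp [rows, bjoin, hyz.1, hyz.2]
      simp [this]
    · have hj1 : bjoin y z i = 1 := by
        unfold bjoin
        split_ifs with h0
        · exact (hz i).resolve_left fun h => hyz ⟨h0, h⟩
        · exact (hy i).resolve_left h0
      refine ih _ ?_ (rows i) hrows rfl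
      rw [← hn]
      refine Set.ncard_lt_ncard ?_ (Set.toFinite _)
      have hsub : {j | rows i j ≠ 1} ⊆ {j | t j ≠ 1} := by
        intro j hj h1
        simp [rows, h1, hj1] at hj
      refine (Set.ssubset_iff_of_subset hsub).2 ?_
      by_cases hy1 : y i = 1
      · exact ⟨p, hp, by simp [rows, hy1, hj1]⟩
      · have hy0 := (hy i).resolve_right hy1
        have hz1 : z i = 1 := (hz i).resolve_left fun h => hyz ⟨hy0, h⟩
        exact ⟨q, hq, by simp [rows, hz1, hj1, Ne.symm hpq]⟩

/-- The minor of `f` separating `y`, `z` and their maximum. -/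
theorem exists_quaternary_minor {k : ℕ} {F : Set Op} {f : (Fin k → D) → D}
    (hF : InClone F ⟨k, f⟩) {y z : Fin k → D} (hy : Bool01 y) (hz : Bool01 z) :
    ∃ r : (Fin 4 → D) → D, InClone F ⟨4, r⟩ ∧ r ![0, 1, 0, 1] = f y ∧
      r ![0, 1, 1, 0] = f z ∧ r ![0, 1, 1, 1] = f (bjoin y z) := by
  let σ : Fin k → Fin 4 := fun i =>
    if y i = 0 then (if z i = 0 then 0 else 2) else (if z i = 0 then 3 else 1)
  refine ⟨fun v => f (fun i => v (σ i)),
    InClone.comp f (fun i v => v (σ i)) hF fun i => InClone.proj (σ i), ?_, ?_, ?_⟩ <;>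
  · dsimp only
    congr 1
    funext i
    simp only [σ, bjoin]
    rcases hy i with h | h <;> rcases hz i with h' | h' <;> simp [h, h']

theorem statement9 {k : ℕ} (f : (Fin k → D) → D)
    (hidem : Idem f)
    (h02 : PreservesSet f {0, 2}) (h12 : PreservesSet f {1, 2})
    (hstar : PropStar f)
    (i₀ : Fin k) (hI : ClassI f = {i₀})
    (hx : ∃ x : Fin k → D, Bool01 x ∧ x i₀ = 0 ∧ (∀ j ∈ ClassII f, x j = 1) ∧ f x = 1) :
    Collapsible {⟨k, f⟩, sOp} ∨
    ∃ r₄ : (Fin 4 → D) → D, InClone {⟨k, f⟩, sOp} ⟨4, r₄⟩ ∧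
      r₄ ![0, 1, 0, 1] = 0 ∧ r₄ ![0, 1, 1, 0] = 0 ∧ r₄ ![0, 1, 1, 1] = 2 := by
  have hdown : ∀ i, i ∉ ClassI f → ∃ y, Bool01 y ∧ f y = 0 ∧ y i = 1 := by
    intro i hi
    obtain ⟨x, hxb, hv, hne⟩ := hstar i
    by_contra hno
    have hno' : ¬ ∃ x, Bool01 x ∧ x i = 1 ∧ f x = 0 :=
      fun ⟨y, hy, hyi, hfy⟩ => hno ⟨y, hy, hfy, hyi⟩
    rcases hv with h | h <;> rcases hxb i with h' | h'
    · exact hne (h.trans h'.symm)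
    · exact hno' ⟨x, hxb, h', h⟩
    · exact hi ⟨⟨x, hxb, h', h⟩, hno'⟩
    · exact hne (h.trans h'.symm)
  have hup : ∀ i, i ∉ ClassII f → ∃ x, Bool01 x ∧ f x = 1 ∧ x i = 0 := by
    intro i hi
    obtain ⟨x, hxb, hv, hne⟩ := hstar i
    by_contra hno
    have hno' : ¬ ∃ x, Bool01 x ∧ x i = 0 ∧ f x = 1 :=
      fun ⟨y, hy, hyi, hfy⟩ => hno ⟨y, hy, hfy, hyi⟩
    rcases hv with h | h <;> rcases hxb i with h' | h'
    · exact hne (h.trans h'.symm)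
    · exact hi ⟨⟨x, hxb, h', h⟩, hno'⟩
    · exact hno' ⟨x, hxb, h', h⟩
    · exact hne (h.trans h'.symm)
  by_cases hB : ∃ y, Bool01 y ∧ f y = 0 ∧ ∀ j ∈ ClassII f, y j = 1
  · left
    refine collapsible_of_matching hidem ?_ ?_
    · obtain ⟨x, hxb, hx0, -, hfx⟩ := hx
      refine ⟨x, hxb, hfx, fun i => ?_⟩
      rcases hxb i with h | h
      · exact ⟨_, fun _ => Or.inl rfl, hidem 0, h.symm⟩
      · rw [h]
        refine hdown i ?_
        rw [hI]
        rintro rfl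
        exact absurd (hx0.symm.trans h) (by decide)
    · obtain ⟨y, hyb, hfy, hy1⟩ := hB
      refine ⟨y, hyb, hfy, fun i => ?_⟩
      rcases hyb i with h | h
      · rw [h]
        exact hup i fun hi => absurd (h.symm.trans (hy1 i hi)) (by decide)
      · exact ⟨_, fun _ => Or.inr rfl, hidem 1, h.symm⟩
  · obtain ⟨y, ⟨hyb, hfy⟩, hmax⟩ := Set.exists_max_image {y | Bool01 y ∧ f y = 0}
      (fun y => {j | j ∈ ClassII f ∧ y j = 1}.ncard) (Set.toFinite _)
      ⟨fun _ => 0, fun _ => Or.inl rfl, hidem 0⟩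
    have hj : ∃ j ∈ ClassII f, y j ≠ 1 := by
      by_contra! h
      exact hB ⟨y, hyb, hfy, h⟩
    obtain ⟨j, hjII, hyj⟩ := hj
    obtain ⟨z, hzb, hzj, hfz⟩ := hjII.1
    have hne : f (bjoin y z) ≠ 0 := by
      intro h0
      refine absurd (hmax _ ⟨bool01_bjoin hyb hzb, h0⟩) (not_le.2 ?_)
      refine Set.ncard_lt_ncard ?_ (Set.toFinite _)
      refine (Set.ssubset_iff_of_subset ?_).2 ⟨j, ⟨hjII, ?_⟩, fun h => hyj h.2⟩
      · rintro l ⟨hl, hyl⟩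
        exact ⟨hl, by simp [bjoin, hyl]⟩
      · simp [bjoin, (hyb j).resolve_right hyj, hzj]
    by_cases h1 : f (bjoin y z) = 1
    · exact Or.inl (collapsible_of_bjoin hyb hzb hfy hfz h1)
    · right
      have h2 : f (bjoin y z) = 2 := by
        generalize f (bjoin y z) = v at hne h1
        revert v
        decide
      obtain ⟨r, hr, hry, hrz, hrj⟩ := exists_quaternary_minor
        (F := {⟨k, f⟩, sOp}) (f := f) (InClone.base (by simp)) hyb hzb
      exact ⟨r, hr, hry.trans hfy, hrz.trans hfz, hrj.trans h2⟩
end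

section
/- Let f be a k-ary idempotent operation on D = {0,1,2} that preserves {0,2} and {1,2} and satisfies property (*), such that neither Class (i) nor Class (ii) is a singleton, and such that f(x) = 2 for every tuple x ∈ {0,1}^k having x_j = 0 for all j in Class (i) and x_j = 1 for all j in Class (ii). Then either the set {f, s} is collapsible, or the clone generated by {f, s} contains 4-ary operations rᵃ₄ and rᵇ₄ with rᵃ₄(0,1,0,1) = rᵃ₄(0,1,1,0) = 0, rᵃ₄(0,1,1,1) = 2, and rᵇ₄(0,1,0,1) = rᵇ₄(0,1,1,0) = 1, rᵇ₄(0,1,0,0) = 2. -/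
/-- The `{0,1}`-tuple with support `S`. -/
def indicator01 {k : ℕ} (S : Finset (Fin k)) : Fin k → D := fun i => if i ∈ S then 1 else 0

theorem bool01_indicator01 {k : ℕ} (S : Finset (Fin k)) : Bool01 (indicator01 S) := by
  intro i
  unfold indicator01
  split_ifs <;> simp

theorem Bool01.exists_eq_indicator01 {k : ℕ} {x : Fin k → D} (hx : Bool01 x) :
    ∃ S, x = indicator01 S := by
  refine ⟨Finset.univ.filter fun i => x i = 1, funext fun i => ?_⟩
  rcases hx i with h | h <;> simp [indicator01, h]

/-- Identify variables of a `k`-ary operation according to membership in `U` and `V`; the four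
variables stand for neither, both, only `U` and only `V`, in this order. -/
def minor4 {k : ℕ} (f : (Fin k → D) → D) (U V : Finset (Fin k)) : (Fin 4 → D) → D :=
  fun y => f fun i => y (if i ∈ U then if i ∈ V then 1 else 2 else if i ∈ V then 3 else 0)

section minor4

variable {k : ℕ} (f : (Fin k → D) → D) (U V : Finset (Fin k))

theorem InClone.minor4 {F : Set Op} {f : (Fin k → D) → D} (hf : InClone F ⟨k, f⟩) :
    InClone F ⟨4, minor4 f U V⟩ :=
  .comp f _ hf fun _ => .proj _

theorem minor4_right : minor4 f U V ![0, 1, 0, 1] = f (indicator01 V) := by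
  refine congrArg f (funext fun i => ?_)
  by_cases hU : i ∈ U <;> by_cases hV : i ∈ V <;> simp [indicator01, hU, hV]

theorem minor4_left : minor4 f U V ![0, 1, 1, 0] = f (indicator01 U) := by
  refine congrArg f (funext fun i => ?_)
  by_cases hU : i ∈ U <;> by_cases hV : i ∈ V <;> simp [indicator01, hU, hV]

theorem minor4_sup : minor4 f U V ![0, 1, 1, 1] = f (indicator01 (U ⊔ V)) := by
  refine congrArg f (funext fun i => ?_)
  by_cases hU : i ∈ U <;> by_cases hV : i ∈ V <;> simp [indicator01, hU, hV]

theorem minor4_inf : minor4 f U V ![0, 1, 0, 0] = f (indicator01 (U ⊓ V)) := by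
  refine congrArg f (funext fun i => ?_)
  by_cases hU : i ∈ U <;> by_cases hV : i ∈ V <;> simp [indicator01, hU, hV]

end minor4

/-- If `f` is idempotent and does not take the value `0` at the join of all `0`-valued
`{0,1}`-tuples, then the `0`-valued tuples are not closed under binary joins. -/
theorem exists_sup_ne_zero {k : ℕ} {f : (Fin k → D) → D} (hidem : Idem f)
    (h : f (indicator01 ((Finset.univ.filter fun S => f (indicator01 S) = 0).sup id)) ≠ 0) :
    ∃ U V, f (indicator01 U) = 0 ∧ f (indicator01 V) = 0 ∧ f (indicator01 (U ⊔ V)) ≠ 0 := by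
  by_contra! hc
  refine h (Finset.sup_induction (p := fun S => f (indicator01 S) = 0) ?_ ?_ ?_)
  · exact (congrArg f (funext fun i => by simp [indicator01])).trans (hidem 0)
  · exact fun U hU V hV => hc U V hU hV
  · simp

theorem exists_inf_ne_one {k : ℕ} {f : (Fin k → D) → D} (hidem : Idem f)
    (h : f (indicator01 ((Finset.univ.filter fun S => f (indicator01 S) = 1).inf id)) ≠ 1) :
    ∃ U V, f (indicator01 U) = 1 ∧ f (indicator01 V) = 1 ∧ f (indicator01 (U ⊓ V)) ≠ 1 := by
  by_contra! hc
  refine h (Finset.inf_induction (p := fun S => f (indicator01 S) = 1) ?_ ?_ ?_)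
  · exact (congrArg f (funext fun i => by simp [indicator01])).trans (hidem 1)
  · exact fun U hU V hV => hc U V hU hV
  · simp

theorem eq_zero_of_mem_classI {k : ℕ} {f : (Fin k → D) → D} {x : Fin k → D} (hx : Bool01 x)
    (hf : f x = 0) {j : Fin k} (hj : j ∈ ClassI f) : x j = 0 :=
  (hx j).resolve_right fun h => hj.2 ⟨x, hx, h, hf⟩

theorem eq_one_of_mem_classII {k : ℕ} {f : (Fin k → D) → D} {x : Fin k → D} (hx : Bool01 x)
    (hf : f x = 1) {j : Fin k} (hj : j ∈ ClassII f) : x j = 1 :=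
  (hx j).resolve_left fun h => hj.2 ⟨x, hx, h, hf⟩

theorem indicator01_eq_zero {k : ℕ} {S : Finset (Fin k)} {j : Fin k} :
    indicator01 S j = 0 ↔ j ∉ S := by
  simp [indicator01]

theorem indicator01_eq_one {k : ℕ} {S : Finset (Fin k)} {j : Fin k} :
    indicator01 S j = 1 ↔ j ∈ S := by
  simp [indicator01]

theorem statement11 {k : ℕ} (f : (Fin k → D) → D)
    (hidem : Idem f)
    (h02 : PreservesSet f {0, 2}) (h12 : PreservesSet f {1, 2})
    (hstar : PropStar f)
    (hI : ¬ ∃ i : Fin k, ClassI f = {i}) (hII : ¬ ∃ i : Fin k, ClassII f = {i})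
    (h2 : ∀ x : Fin k → D, Bool01 x → (∀ j ∈ ClassI f, x j = 0) →
      (∀ j ∈ ClassII f, x j = 1) → f x = 2) :
    Collapsible {⟨k, f⟩, sOp} ∨
    ∃ ra rb : (Fin 4 → D) → D,
      InClone {⟨k, f⟩, sOp} ⟨4, ra⟩ ∧ InClone {⟨k, f⟩, sOp} ⟨4, rb⟩ ∧
      ra ![0, 1, 0, 1] = 0 ∧ ra ![0, 1, 1, 0] = 0 ∧ ra ![0, 1, 1, 1] = 2 ∧
      rb ![0, 1, 0, 1] = 1 ∧ rb ![0, 1, 1, 0] = 1 ∧ rb ![0, 1, 0, 0] = 2 := by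
  have hf : InClone {⟨k, f⟩, sOp} ⟨k, f⟩ := .base (Set.mem_insert _ _)
  have notMem {S : Finset (Fin k)} (hS : f (indicator01 S) = 0) {j} (hj : j ∈ ClassI f) : j ∉ S :=
    indicator01_eq_zero.1 (eq_zero_of_mem_classI (bool01_indicator01 S) hS hj)
  have mem {S : Finset (Fin k)} (hS : f (indicator01 S) = 1) {j} (hj : j ∈ ClassII f) : j ∈ S :=
    indicator01_eq_one.1 (eq_one_of_mem_classII (bool01_indicator01 S) hS hj)
  have two {S : Finset (Fin k)} (hSI : ∀ j ∈ ClassI f, j ∉ S) (hSII : ∀ j ∈ ClassII f, j ∈ S) :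
      f (indicator01 S) = 2 :=
    h2 _ (bool01_indicator01 S) (fun j hj => indicator01_eq_zero.2 (hSI j hj))
      fun j hj => indicator01_eq_one.2 (hSII j hj)
  have eq_two : ∀ d : D, d ≠ 0 → d ≠ 1 → d = 2 := by decide
  obtain ⟨U, V, hU, hV, hUV⟩ := exists_sup_ne_zero hidem <| by
    rw [two]
    · decide
    · intro j hj hmem
      obtain ⟨S, hS, hjS⟩ := Finset.mem_sup.1 hmem
      exact notMem (Finset.mem_filter.1 hS).2 hj hjS
    · rintro j ⟨⟨x, hx, hxj, hfx⟩, -⟩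
      obtain ⟨S, rfl⟩ := hx.exists_eq_indicator01
      exact Finset.mem_sup.2 ⟨S, by simpa using hfx, indicator01_eq_one.1 hxj⟩
  obtain ⟨U', V', hU', hV', hUV'⟩ := exists_inf_ne_one hidem <| by
    rw [two]
    · decide
    · rintro j ⟨⟨x, hx, hxj, hfx⟩, -⟩ hmem
      obtain ⟨S, rfl⟩ := hx.exists_eq_indicator01
      exact indicator01_eq_zero.1 hxj (Finset.mem_inf.1 hmem S (by simpa using hfx))
    · exact fun j hj => Finset.mem_inf.2 fun S hS => mem (Finset.mem_filter.1 hS).2 hj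
  refine .inr ⟨minor4 f U V, minor4 f U' V', hf.minor4 U V, hf.minor4 U' V',
    (minor4_right ..).trans hV, (minor4_left ..).trans hU, (minor4_sup ..).trans ?_,
    (minor4_right ..).trans hV', (minor4_left ..).trans hU', (minor4_inf ..).trans ?_⟩
  · refine eq_two _ hUV fun h => ?_
    have hSI : ∀ j ∈ ClassI f, j ∉ U ⊔ V := fun j hj hmem =>
      (Finset.mem_union.1 hmem).elim (notMem hU hj) (notMem hV hj)
    exact absurd ((two hSI fun j hj => mem h hj).symm.trans h) (by decide)
  · refine eq_two _ (fun h => ?_) hUV'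
    have hSII : ∀ j ∈ ClassII f, j ∈ U' ⊓ V' := fun j hj =>
      Finset.mem_inter.2 ⟨mem hU' hj, mem hV' hj⟩
    exact absurd ((two (fun j hj => notMem h hj) hSII).symm.trans h) (by decide)
end

section
/- Let F be a Gap Algebra such that some operation of F is not {0,2}{1,2}-projective and such that F satisfies the Zhuk Condition. Then for every finite subset Δ of Inv(F), the clone Pol(Δ) is collapsible. -/
/-- An n-ary operation preserves an h-ary relation on `D`. -/
def OpPreservesRel {n h : ℕ} (g : (Fin n → D) → D) (ρ : Set (Fin h → D)) : Prop :=
  ∀ t : Fin n → Fin h → D, (∀ i, t i ∈ ρ) → (fun j => g (fun i => t i j)) ∈ ρ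

/-- `ρ ∈ Inv(F)`: the relation is preserved by every operation of `F`. -/
def InInv (F : Set Op) {h : ℕ} (ρ : Set (Fin h → D)) : Prop :=
  ∀ g ∈ F, OpPreservesRel g.2 ρ

/-- A Gap Algebra: a set of idempotent operations on `D` containing `s`,
all preserving `{0,2}` and `{1,2}`, that is not collapsible. -/
def GapAlgebra (F : Set Op) : Prop :=
  sOp ∈ F ∧
  (∀ g ∈ F, Idem g.2 ∧ PreservesSet g.2 {0, 2} ∧ PreservesSet g.2 {1, 2}) ∧
  ¬ Collapsible F

/-- An operation is `{0,2}{1,2}`-projective. -/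
def Proj0212 {n : ℕ} (g : (Fin n → D) → D) : Prop :=
  ∃ i : Fin n, ∀ x : Fin n → D,
    (x i ∈ ({0, 2} : Set D) → g x ∈ ({0, 2} : Set D)) ∧
    (x i ∈ ({1, 2} : Set D) → g x ∈ ({1, 2} : Set D))

/-- The Zhuk Condition for a set `F` of operations on `D`. -/
def ZhukCondition (F : Set Op) : Prop :=
  ∃ p : (Fin 2 → D) → D, ∃ r₃ : (Fin 3 → D) → D,
    InClone F ⟨2, p⟩ ∧ InClone F ⟨3, r₃⟩ ∧ Idem p ∧ Idem r₃ ∧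
    ((p ![0, 1] = 0 ∧ p ![0, 2] = 2 ∧
      r₃ ![0, 0, 1] = 0 ∧ r₃ ![0, 1, 0] = 0 ∧ r₃ ![0, 1, 1] = 2) ∨
     (p ![0, 1] = 1 ∧ p ![2, 1] = 2 ∧
      r₃ ![1, 0, 1] = 1 ∧ r₃ ![1, 1, 0] = 1 ∧ r₃ ![1, 0, 0] = 2))

/-- A finitary relation on `D`, packaged with its arity. -/
abbrev RelD : Type := Σ h : ℕ, Set (Fin h → D)

/-- `Pol(Δ)`: the operations preserving every relation of `Δ`. -/
def PolSet (Δ : Set RelD) : Set Op := {g | ∀ ρ ∈ Δ, OpPreservesRel g.2 ρ.2}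

/-! ### The meet operation and elementary facts about `D` -/

/-- The operation `s` in curried form. -/
def meet (x y : D) : D := if x = y then x else 2

@[simp] theorem meet_self (x : D) : meet x x = x := if_pos rfl

@[simp] theorem meet_two (x : D) : meet x 2 = 2 := by revert x; decide

@[simp] theorem two_meet (x : D) : meet 2 x = 2 := by revert x; decide

theorem meet_of_ne {x y : D} (h : x ≠ y) : meet x y = 2 := if_neg h

theorem D_cases {a b : D} (hab : a ≠ b) (ha : a ≠ 2) (hb : b ≠ 2) (x : D) :
    x = a ∨ x = b ∨ x = 2 := by
  revert a b x; decide

/-! ### Terms -/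

/-- `f` is a binary term operation of `F`. -/
def IsTerm2 (F : Set Op) (f : D → D → D) : Prop := InClone F ⟨2, fun x => f (x 0) (x 1)⟩

/-- `f` is a ternary term operation of `F`. -/
def IsTerm3 (F : Set Op) (f : D → D → D → D) : Prop :=
  InClone F ⟨3, fun x => f (x 0) (x 1) (x 2)⟩

section Terms

variable {F : Set Op} {m : ℕ}

theorem InClone.comp2 {p : (Fin 2 → D) → D} {g k : (Fin m → D) → D}
    (hp : InClone F ⟨2, p⟩) (hg : InClone F ⟨m, g⟩) (hk : InClone F ⟨m, k⟩) :
    InClone F ⟨m, fun x => p ![g x, k x]⟩ := by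
  have h := InClone.comp p ![g, k] hp (fun i => by fin_cases i <;> assumption)
  convert h using 4 with x
  funext i
  fin_cases i <;> rfl

theorem InClone.comp3 {p : (Fin 3 → D) → D} {g k l : (Fin m → D) → D}
    (hp : InClone F ⟨3, p⟩) (hg : InClone F ⟨m, g⟩) (hk : InClone F ⟨m, k⟩)
    (hl : InClone F ⟨m, l⟩) :
    InClone F ⟨m, fun x => p ![g x, k x, l x]⟩ := by
  have h := InClone.comp p ![g, k, l] hp (fun i => by fin_cases i <;> assumption)
  convert h using 4 with x
  funext i
  fin_cases i <;> rfl

theorem IsTerm2.comp {f : D → D → D} {g k : (Fin m → D) → D}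
    (hf : IsTerm2 F f) (hg : InClone F ⟨m, g⟩) (hk : InClone F ⟨m, k⟩) :
    InClone F ⟨m, fun x => f (g x) (k x)⟩ :=
  InClone.comp2 hf hg hk

theorem IsTerm3.comp {f : D → D → D → D} {g k l : (Fin m → D) → D}
    (hf : IsTerm3 F f) (hg : InClone F ⟨m, g⟩) (hk : InClone F ⟨m, k⟩)
    (hl : InClone F ⟨m, l⟩) :
    InClone F ⟨m, fun x => f (g x) (k x) (l x)⟩ :=
  InClone.comp3 hf hg hk hl

theorem isTerm2_meet (hs : sOp ∈ F) : IsTerm2 F meet := InClone.base hs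

theorem InClone.preservesRel {g : Op} (hg : InClone F g) {h : ℕ} {ρ : Set (Fin h → D)}
    (hρ : InInv F ρ) : OpPreservesRel g.2 ρ := by
  induction hg with
  | base hg => exact hρ _ hg
  | proj i => exact fun t ht => ht i
  | comp f g _ _ ihf ihg => exact fun t ht => ihf _ fun i => ihg i t ht

theorem InClone.preservesSet {g : Op} (hg : InClone F g) {B : Set D}
    (hB : ∀ g ∈ F, PreservesSet g.2 B) : PreservesSet g.2 B := by
  induction hg with
  | base hg => exact hB _ hg
  | proj i => exact fun t ht => ht i
  | comp f g _ _ ihf ihg => exact fun t ht => ihf _ fun i => ihg i t ht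

theorem InClone.idem {g : Op} (hg : InClone F g) (hF : ∀ g ∈ F, Idem g.2) : Idem g.2 := by
  intro x
  refine hg.preservesSet (B := {x}) (fun g hg y hy => ?_) (fun _ => x) fun _ => rfl
  rw [show y = fun _ => x from funext hy]
  exact hF g hg x

theorem IsTerm2.idem {f : D → D → D} (hf : IsTerm2 F f) (hF : ∀ g ∈ F, Idem g.2) (x : D) :
    f x x = x :=
  InClone.idem hf hF x

theorem IsTerm3.idem {f : D → D → D → D} (hf : IsTerm3 F f) (hF : ∀ g ∈ F, Idem g.2) (x : D) :
    f x x x = x :=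
  InClone.idem hf hF x

theorem IsTerm2.mem_rel {f : D → D → D} (hf : IsTerm2 F f) {h : ℕ} {ρ : Set (Fin h → D)}
    (hρ : InInv F ρ) {u v : Fin h → D} (hu : u ∈ ρ) (hv : v ∈ ρ) :
    (fun j => f (u j) (v j)) ∈ ρ :=
  InClone.preservesRel hf hρ ![u, v] fun i => by fin_cases i <;> assumption

theorem IsTerm3.mem_rel {f : D → D → D → D} (hf : IsTerm3 F f) {h : ℕ} {ρ : Set (Fin h → D)}
    (hρ : InInv F ρ) {u v w : Fin h → D} (hu : u ∈ ρ) (hv : v ∈ ρ) (hw : w ∈ ρ) :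
    (fun j => f (u j) (v j) (w j)) ∈ ρ :=
  InClone.preservesRel hf hρ ![u, v, w] fun i => by fin_cases i <;> assumption

theorem IsTerm2.two_or {f : D → D → D} (hf : IsTerm2 F f) {b : D}
    (hb : ∀ g ∈ F, PreservesSet g.2 {b, 2}) : f b 2 = b ∨ f b 2 = 2 :=
  InClone.preservesSet hf hb ![b, 2] fun i => by fin_cases i <;> simp

theorem InClosure.meet (hs : sOp ∈ F) {S : Set (Fin m → D)} {u v : Fin m → D}
    (hu : InClosure F S u) (hv : InClosure F S v) :
    InClosure F S (fun j => meet (u j) (v j)) :=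
  InClosure.app sFun ![u, v] (InClone.base hs) fun i => by fin_cases i <;> assumption

end Terms

/-! ### A sufficient condition for collapsibility -/

/-- Replace `2` by `a` (if the flag is set) or by `b` (otherwise). -/
def resolve (a b : D) (β : Bool) (x : D) : D := if x = 2 then (if β then a else b) else x

theorem meet_resolve {a b : D} (hab : a ≠ b) (β : Bool) (x : D) :
    meet (resolve a b β x) (resolve a b (!β) x) = x := by
  by_cases hx : x = 2
  · cases β
    · simp [resolve, hx, meet_of_ne hab.symm]
    · simp [resolve, hx, meet_of_ne hab]
  · simp [resolve, hx]

theorem resolve_mem {a b : D} (hab : a ≠ b) (ha : a ≠ 2) (hb : b ≠ 2) (β : Bool) (x : D) :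
    resolve a b β x = a ∨ resolve a b β x = b := by
  unfold resolve
  split_ifs with hx h
  · exact .inl rfl
  · exact .inr rfl
  · rcases D_cases hab ha hb x with h | h | h
    · exact .inl h
    · exact .inr h
    · exact absurd h hx

/-- If a term fixes the constants `a`, `b` and takes the value `b` at points avoiding `b` in any
prescribed coordinate, then the algebra is collapsible. -/
theorem collapsible_of_forall_exists {G : Set Op} {a b : D} (hab : a ≠ b) (ha : a ≠ 2) (hb : b ≠ 2)
    (hs : sOp ∈ G) {n : ℕ} {f : (Fin n → D) → D} (hf : InClone G ⟨n, f⟩)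
    (hfa : f (fun _ => a) = a) (hfb : f (fun _ => b) = b)
    (hfx : ∀ i, ∃ x, f x = b ∧ x i ≠ b) : Collapsible G := by
  have hn : Nonempty (Fin n × Bool) := by
    rcases n with _ | n
    · exact absurd (hfa.symm.trans ((congrArg f (Subsingleton.elim _ _)).trans hfb)) hab
    · exact ⟨(0, true)⟩
  choose x hx hxne using hfx
  refine ⟨2 * n, fun m _ t => ?_⟩
  have key : ∀ c : ℕ, ∀ u : Fin m → D, (∀ j, u j = a ∨ u j = b) →
      Fintype.card {j // u j = b} = c → InClosure G (Lam m (2 * n)) u := by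
    intro c
    induction c using Nat.strong_induction_on with
    | _ c ih =>
    intro u hu hc
    by_cases hle : c ≤ 2 * n
    · refine .base ⟨a, ?_⟩
      have hcompl : {i | u i = a} = {i | u i = b}ᶜ := by
        ext j
        rcases hu j with h | h <;> simp [h, hab, hab.symm]
      have hb' : Set.ncard {i | u i = b} = c := by
        rw [← hc, ← Nat.card_eq_fintype_card]; rfl
      have := Set.ncard_add_ncard_compl {i | u i = b}
      rw [hcompl]
      simp only [Nat.card_eq_fintype_card, Fintype.card_fin] at this
      omega
    · have hcard : Fintype.card (Fin n × Bool) ≤ Fintype.card {j // u j = b} := by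
        simp only [Fintype.card_prod, Fintype.card_fin, Fintype.card_bool]
        omega
      obtain ⟨e⟩ := Function.Embedding.nonempty_of_card_le hcard
      let φ : Fin m → Fin n × Bool := Function.invFun fun q => (e q).1
      have hφ : ∀ q, φ (e q).1 = q :=
        Function.leftInverse_invFun (Subtype.val_injective.comp e.injective)
      let y : Bool → Fin n → Fin m → D := fun β j l =>
        if u l = b then resolve a b ((φ l).2 == β) (x (φ l).1 j) else a
      have hy : ∀ β j, InClosure G (Lam m (2 * n)) (y β j) := by
        intro β j
        refine ih _ ?_ (y β j) (fun l => ?_) rfl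
        · rw [← hc]
          have himp : ∀ l, y β j l = b → u l = b := fun l hl => by
            by_contra hne
            exact hab (by simpa [y, hne] using hl)
          refine Fintype.card_lt_of_injective_of_notMem
            (fun l : {l // y β j l = b} => (⟨l.1, himp l.1 l.2⟩ : {l // u l = b}))
            (fun l l' h => Subtype.ext (Subtype.mk.inj h)) (b := e (j, β)) ?_
          rintro ⟨⟨l, hl⟩, hle⟩
          have hl' : l = (e (j, β)).1 := congrArg Subtype.val hle
          subst hl'
          simp only [y, (e (j, β)).2, hφ, if_true, beq_self_eq_true, resolve] at hl
          split_ifs at hl with h2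
          · exact hab hl
          · exact hxne j hl
        · simp only [y]
          split_ifs with h
          · exact resolve_mem hab ha hb _ _
          · exact .inl rfl
      have hrow : ∀ l, (fun j => meet (y true j l) (y false j l)) =
          if u l = b then x (φ l).1 else fun _ => a := by
        intro l
        funext j
        by_cases h : u l = b
        · simp only [y, h, if_true]
          have := meet_resolve hab ((φ l).2 == true) (x (φ l).1 j)
          revert this
          cases (φ l).2 <;> simp
        · simp [y, h]
      have happ := InClosure.app f _ hf fun j => InClosure.meet hs (hy true j) (hy false j)
      convert happ using 1
      funext l
      rw [hrow]
      rcases hu l with h | h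
      · rw [if_neg (h ▸ hab), hfa, h]
      · rw [if_pos h, hx, h]
  have hres : ∀ β, InClosure G (Lam m (2 * n)) (fun j => resolve a b β (t j)) := fun β =>
    key _ _ (fun j => resolve_mem hab ha hb β (t j)) rfl
  simpa only [← Bool.not_true, meet_resolve hab] using InClosure.meet hs (hres true) (hres (!true))

/-! ### Near-unanimity operations preserving finitely many relations -/

theorem mem_of_meet_closed {h : ℕ} {ρ : Set (Fin h → D)}
    (hρ : ∀ u ∈ ρ, ∀ v ∈ ρ, (fun j => meet (u j) (v j)) ∈ ρ) {g : Fin h → D}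
    {u₀ : Fin h → D} (hu₀ : u₀ ∈ ρ) (hg₀ : ∀ j, g j ≠ 2 → u₀ j = g j)
    (hg : ∀ j, g j = 2 → ∃ u ∈ ρ, (∀ j, g j ≠ 2 → u j = g j) ∧ u j = 2) : g ∈ ρ := by
  have key : ∀ J : Finset (Fin h), ∃ u ∈ ρ, (∀ j, g j ≠ 2 → u j = g j) ∧
      ∀ j ∈ J, g j = 2 → u j = 2 := by
    intro J
    induction J using Finset.induction_on with
    | empty => exact ⟨u₀, hu₀, hg₀, by simp⟩
    | insert i J _ ih =>
      obtain ⟨u, hu, hug, huJ⟩ := ih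
      by_cases hi : g i = 2
      · obtain ⟨v, hv, hvg, hvi⟩ := hg i hi
        refine ⟨_, hρ u hu v hv, fun j hj => by simp [hug j hj, hvg j hj], fun j hj hj2 => ?_⟩
        rcases Finset.mem_insert.1 hj with rfl | hj
        · simp [hvi]
        · simp [huJ j hj hj2]
      · refine ⟨u, hu, hug, fun j hj hj2 => ?_⟩
        rcases Finset.mem_insert.1 hj with rfl | hj
        · exact absurd hj2 hi
        · exact huJ j hj hj2
  obtain ⟨u, hu, hug, huJ⟩ := key Finset.univ
  convert hu
  funext j
  by_cases hj : g j = 2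
  · rw [hj, huJ j (Finset.mem_univ j) hj]
  · rw [hug j hj]

/-- All entries equal `b`, up to at most one exception, which lies in `E`. -/
def NearConst (b : D) (E : Set D) {n : ℕ} (d : Fin n → D) : Prop :=
  (∀ i, d i = b ∨ d i ∈ E) ∧ ∀ i j, d i ≠ b → d j ≠ b → i = j

open Classical in
/-- The operation that is `b` on nearly constant `b` tuples, `a` on the constant `a` tuple, and
`2` elsewhere. -/
noncomputable def nearUnanimity (a b : D) (E : Set D) (n : ℕ) (d : Fin n → D) : D :=
  if NearConst b E d then b else if ∀ i, d i = a then a else 2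

/-- Agreement with term operations on any few columns makes `nearUnanimity` preserve every
invariant relation of smaller arity. -/
theorem opPreservesRel_nearUnanimity {F : Set Op} {a b : D} (hab : a ≠ b) (ha : a ≠ 2) (hb : b ≠ 2)
    (hs : sOp ∈ F) (hF : ∀ g ∈ F, Idem g.2) {E : Set D}
    {w : D → D → D} (hw : IsTerm2 F w) (hwE : ∀ e ∈ E, w b e = b)
    (hwE' : ∀ e ∉ E, e ≠ b → w b e = 2) (hwa : ∀ e, e ≠ a → w a e = 2)
    {κ : D → D → D → D} (hκ : IsTerm3 F κ) (hκl : ∀ e ∈ E, κ b e b = b)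
    (hκr : ∀ e ∈ E, κ b b e = b) (hκ2 : ∀ e ∈ E, ∀ e' ∈ E, κ b e e' = 2)
    {h n : ℕ} (hn : h < n) {ρ : Set (Fin h → D)} (hρ : InInv F ρ) :
    OpPreservesRel (nearUnanimity a b E n) ρ := by
  intro t ht
  obtain ⟨i, hi⟩ : ∃ i : Fin n, ∀ j, NearConst b E (fun l => t l j) → t i j = b := by
    by_contra! hcon
    choose c hc hcne using hcon
    obtain ⟨i, i', hne, hcc⟩ := Fintype.exists_ne_map_eq_of_card_lt c (by simpa using hn)
    exact hne ((hc i).2 i i' (hcne i) (hcc ▸ hcne i'))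
  have hval : ∀ j, nearUnanimity a b E n (fun l => t l j) ≠ 2 →
      (NearConst b E (fun l => t l j) ∧ nearUnanimity a b E n (fun l => t l j) = b) ∨
      ((∀ l, t l j = a) ∧ nearUnanimity a b E n (fun l => t l j) = a) := by
    intro j hj
    unfold nearUnanimity at hj ⊢
    split_ifs with h₁ h₂
    · exact .inl ⟨h₁, rfl⟩
    · exact .inr ⟨h₂, rfl⟩
    · simp [h₁, h₂] at hj
  have hwval : ∀ k j, nearUnanimity a b E n (fun l => t l j) ≠ 2 →
      w (t i j) (t k j) = nearUnanimity a b E n (fun l => t l j) := by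
    intro k j hj
    rcases hval j hj with ⟨h₁, h₂⟩ | ⟨h₁, h₂⟩
    · rw [h₂, hi j h₁]
      rcases h₁.1 k with h | h
      · rw [show t k j = b from h, hw.idem hF]
      · exact hwE _ h
    · rw [h₂, h₁, h₁, hw.idem hF]
  have hκval : ∀ k k', k ≠ k' → ∀ j, nearUnanimity a b E n (fun l => t l j) ≠ 2 →
      κ (t i j) (t k j) (t k' j) = nearUnanimity a b E n (fun l => t l j) := by
    intro k k' hkk j hj
    rcases hval j hj with ⟨h₁, h₂⟩ | ⟨h₁, h₂⟩
    · rw [h₂, hi j h₁]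
      by_cases hk : t k j = b
      · rw [hk]
        rcases h₁.1 k' with h | h
        · rw [show t k' j = b from h, hκ.idem hF]
        · exact hκr _ h
      · have hk' : t k' j = b := by
          by_contra hne
          exact hkk (h₁.2 k k' hk hne)
        rw [hk']
        exact hκl _ ((h₁.1 k).resolve_left hk)
    · rw [h₂, h₁, h₁, h₁, hκ.idem hF]
  refine mem_of_meet_closed (fun u hu v hv => (isTerm2_meet hs).mem_rel hρ hu hv) (ht i) ?_ ?_
  · intro j hj
    rcases hval j hj with ⟨h₁, h₂⟩ | ⟨h₁, h₂⟩
    · rw [h₂, hi j h₁]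
    · rw [h₂, h₁]
  · intro j hj
    have hnc : ¬ NearConst b E (fun l => t l j) := fun hc => hb (by
      rw [← hj, nearUnanimity, if_pos hc])
    have hna : ¬ ∀ l, t l j = a := fun hc => ha (by
      rw [← hj, nearUnanimity, if_neg hnc, if_pos hc])
    rcases D_cases hab ha hb (t i j) with hij | hij | hij
    · obtain ⟨k, hk⟩ := not_forall.1 hna
      exact ⟨_, hw.mem_rel hρ (ht i) (ht k), hwval k, by simp only [hij, hwa _ hk]⟩
    · by_cases hE : ∀ l, t l j = b ∨ t l j ∈ E
      · obtain ⟨k, k', hk, hk', hkk⟩ : ∃ k k', t k j ≠ b ∧ t k' j ≠ b ∧ k ≠ k' := by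
          by_contra! hcon
          exact hnc ⟨hE, hcon⟩
        refine ⟨_, hκ.mem_rel hρ (ht i) (ht k) (ht k'), hκval k k' hkk, ?_⟩
        simp only [hij]
        exact hκ2 _ ((hE k).resolve_left hk) _ ((hE k').resolve_left hk')
      · push Not at hE
        obtain ⟨k, hk, hkE⟩ := hE
        exact ⟨_, hw.mem_rel hρ (ht i) (ht k), hwval k, by simp only [hij, hwE' _ hkE hk]⟩
    · refine ⟨t i, ht i, fun j hj => ?_, hij⟩
      rcases hval j hj with ⟨h₁, h₂⟩ | ⟨h₁, h₂⟩
      · rw [h₂, hi j h₁]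
      · rw [h₂, h₁]

theorem collapsible_polSet_of_terms {F : Set Op} {a b : D} (hab : a ≠ b) (ha : a ≠ 2) (hb : b ≠ 2)
    (hs : sOp ∈ F) (hF : ∀ g ∈ F, Idem g.2) {E : Set D} (haE : a ∈ E)
    {w : D → D → D} (hw : IsTerm2 F w) (hwE : ∀ e ∈ E, w b e = b)
    (hwE' : ∀ e ∉ E, e ≠ b → w b e = 2) (hwa : ∀ e, e ≠ a → w a e = 2)
    {κ : D → D → D → D} (hκ : IsTerm3 F κ) (hκl : ∀ e ∈ E, κ b e b = b)
    (hκr : ∀ e ∈ E, κ b b e = b) (hκ2 : ∀ e ∈ E, ∀ e' ∈ E, κ b e e' = 2)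
    {Δ : Set RelD} (hfin : Δ.Finite) (hsub : ∀ ρ ∈ Δ, InInv F ρ.2) :
    Collapsible (PolSet Δ) := by
  obtain ⟨h, hh⟩ := (hfin.image Sigma.fst).bddAbove
  have hmem : (⟨h + 2, nearUnanimity a b E (h + 2)⟩ : Op) ∈ PolSet Δ := fun ρ hρ =>
    opPreservesRel_nearUnanimity hab ha hb hs hF hw hwE hwE' hwa hκ hκl hκr hκ2
      (Nat.lt_of_le_of_lt (hh ⟨ρ, hρ, rfl⟩) (Nat.lt_add_of_pos_right two_pos)) (hsub ρ hρ)
  refine collapsible_of_forall_exists hab ha hb (fun ρ hρ => hsub ρ hρ _ hs) (.base hmem) ?_ ?_ ?_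
  · have hnc : ¬ NearConst b E (fun _ : Fin (h + 2) => a) := fun hc => by
      simpa using hc.2 0 1 hab hab
    rw [nearUnanimity, if_neg hnc, if_pos fun _ => rfl]
  · exact if_pos ⟨fun _ => .inl rfl, fun _ _ hne => absurd rfl hne⟩
  · intro i
    refine ⟨Function.update (fun _ => b) i a, if_pos ⟨fun j => ?_, fun j k hj hk => ?_⟩, by simpa⟩
    · by_cases hji : j = i
      · subst hji; simp [haE]
      · simp [hji]
    · have : ∀ l, Function.update (fun _ => b) i a l ≠ b → l = i := fun l hl => by
        by_contra hne
        simp [hne] at hl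
      rw [this j hj, this k hk]

/-! ### Constructing the required terms -/

section Construction

variable {F : Set Op} {a b : D}

/-- `x` with its entries `a`, `b`, `2` replaced by `c`, `e`, `c ∧ e`. -/
def substitute (a b : D) {n : ℕ} (x : Fin n → D) (c e : D) : Fin n → D := fun i =>
  if x i = a then c else if x i = b then e else meet c e

theorem isTerm2_substitute (hs : sOp ∈ F) {n : ℕ} {f : (Fin n → D) → D} (hf : InClone F ⟨n, f⟩)
    (x : Fin n → D) : IsTerm2 F fun c e => f (substitute a b x c e) := by
  refine InClone.comp f (fun i y => substitute a b x (y 0) (y 1) i) hf fun i => ?_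
  unfold substitute
  split_ifs
  · exact .proj 0
  · exact .proj 1
  · exact (isTerm2_meet hs).comp (.proj 0) (.proj 1)

theorem substitute_self (hab : a ≠ b) (ha : a ≠ 2) (hb : b ≠ 2) {n : ℕ} (x : Fin n → D) :
    substitute a b x a b = x := by
  funext i
  unfold substitute
  rcases D_cases hab ha hb (x i) with h | h | h
  · simp [h]
  · simp [h, hab.symm]
  · simp [h, ha.symm, hb.symm, meet_of_ne hab]

theorem exists_witness_of_not_proj (hab : a ≠ b) (ha : a ≠ 2) (hb : b ≠ 2) {n : ℕ}
    {f : (Fin n → D) → D} (hf : ¬ Proj0212 f) (i : Fin n) :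
    ∃ x, (x i ≠ a ∧ f x = a) ∨ (x i ≠ b ∧ f x = b) := by
  simp only [Proj0212, not_exists, not_forall] at hf
  obtain ⟨x, hx⟩ := hf i
  refine ⟨x, ?_⟩
  simp only [Set.mem_insert_iff, Set.mem_singleton_iff] at hx
  generalize x i = y at *
  generalize f x = z at *
  revert a b y z
  decide

/-- In a non-collapsible algebra that is not projective, some binary term is `a` at `(a, b)` and
`2` at `(b, a)`. -/
theorem exists_asymmetric_term (hab : a ≠ b) (ha : a ≠ 2) (hb : b ≠ 2) (hs : sOp ∈ F)
    (hF : ∀ g ∈ F, Idem g.2) (hnc : ¬ Collapsible F) {g : Op} (hg : g ∈ F)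
    (hproj : ¬ Proj0212 g.2) : ∃ v, IsTerm2 F v ∧ v a b = a ∧ v b a = 2 := by
  by_contra! hcon
  have hflip : ∀ V, IsTerm2 F V → V a b = a → V b a = b := by
    intro V hV hVab
    rcases D_cases hab ha hb (V b a) with h | h | h
    · refine absurd (collapsible_of_forall_exists hab.symm hb ha hs hV (hV.idem hF b)
        (hV.idem hF a) fun i => ?_) hnc
      fin_cases i
      · exact ⟨![b, a], h, hab.symm⟩
      · exact ⟨![a, b], hVab, hab.symm⟩
    · exact h
    · exact absurd h (hcon V hV hVab)
  refine hnc (collapsible_of_forall_exists hab ha hb hs (.base hg) (hF g hg a) (hF g hg b) ?_)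
  intro i
  obtain ⟨x, ⟨hxi, hx⟩ | ⟨hxi, hx⟩⟩ := exists_witness_of_not_proj hab ha hb hproj i
  · refine ⟨substitute a b x b a, hflip _ (isTerm2_substitute hs (.base hg) x) ?_, ?_⟩
    · rw [substitute_self hab ha hb, hx]
    · unfold substitute
      rw [if_neg hxi, meet_of_ne hab.symm]
      split_ifs
      · exact hab
      · exact hb.symm
  · exact ⟨x, hx, hxi⟩

/-- If noise never turns `b` into `2`, some ternary term detects two simultaneous drops. -/
theorem exists_double_drop_term (hab : a ≠ b) (ha : a ≠ 2) (hb : b ≠ 2) (hs : sOp ∈ F)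
    (hF : ∀ g ∈ F, Idem g.2) (hFb : ∀ g ∈ F, PreservesSet g.2 {b, 2})
    (hV : ∀ V, IsTerm2 F V → V a b = a → V b 2 = b)
    (hW : ∀ W, IsTerm2 F W → W b a = b → W b 2 = b)
    {f : Op} (hf : f ∈ F) (hproj : ¬ Proj0212 f.2) :
    ∃ g, IsTerm3 F g ∧ g b b a = b ∧ g b 2 b = b ∧ g b 2 2 = 2 := by
  by_contra! hcon
  let tup (T : Finset (Fin f.1)) : Fin f.1 → D := fun i => if i ∈ T then b else 2
  have hinter : ∀ S T, f.2 (tup S) = b → f.2 (tup T) = b → f.2 (tup (S ∩ T)) = b := by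
    intro S T hS hT
    let g : D → D → D → D := fun x y z => f.2 fun i =>
      if i ∈ S then (if i ∈ T then x else y) else (if i ∈ T then meet x z else meet y z)
    have hg : IsTerm3 F g := by
      refine InClone.comp f.2 (fun i x => if i ∈ S then (if i ∈ T then x 0 else x 1) else
        (if i ∈ T then meet (x 0) (x 2) else meet (x 1) (x 2))) (.base hf) fun i => ?_
      split_ifs
      · exact .proj 0
      · exact .proj 1
      · exact (isTerm2_meet hs).comp (.proj 0) (.proj 2)
      · exact (isTerm2_meet hs).comp (.proj 1) (.proj 2)
    have h₁ : g b b a = b := by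
      refine Eq.trans (b := f.2 (tup S)) (congrArg f.2 (funext fun i => ?_)) hS
      by_cases h : i ∈ S <;> simp [tup, h, meet_of_ne hab.symm]
    have h₂ : g b 2 b = b := by
      refine Eq.trans (b := f.2 (tup T)) (congrArg f.2 (funext fun i => ?_)) hT
      by_cases h : i ∈ S <;> simp [tup, h]
    have h₃ : g b 2 2 = f.2 (tup (S ∩ T)) := by
      refine congrArg f.2 (funext fun i => ?_)
      by_cases h : i ∈ S <;> simp [tup, h]
    refine (hFb f hf (tup (S ∩ T)) fun i => ?_).resolve_right fun h => ?_
    · by_cases h : i ∈ S ∩ T <;> simp [tup, h]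
    · exact hcon g hg h₁ h₂ (h₃.trans h)
  have hsingle : ∀ i, ∃ T, i ∉ T ∧ f.2 (tup T) = b := by
    intro i
    obtain ⟨x, ⟨hxi, hx⟩ | ⟨hxi, hx⟩⟩ := exists_witness_of_not_proj hab ha hb hproj i
    · refine ⟨Finset.univ.filter fun j => x j = a, by simpa using hxi, ?_⟩
      refine Eq.trans (congrArg f.2 (funext fun j => ?_))
        (hV _ (isTerm2_substitute (a := a) (b := b) hs (.base hf) x)
          (by rw [substitute_self hab ha hb, hx]))
      simp [tup, substitute]
    · refine ⟨Finset.univ.filter fun j => x j = b, by simpa using hxi, ?_⟩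
      refine Eq.trans (congrArg f.2 (funext fun j => ?_))
        (hW _ (isTerm2_substitute (a := b) (b := a) hs (.base hf) x)
          (by rw [substitute_self hab.symm hb ha, hx]))
      simp [tup, substitute]
  have hall : ∀ J : Finset (Fin f.1), ∃ T, Disjoint J T ∧ f.2 (tup T) = b := by
    intro J
    induction J using Finset.induction_on with
    | empty => exact ⟨Finset.univ, by simp, by simpa [tup] using hF f hf b⟩
    | insert i J _ ih =>
      obtain ⟨T, hJT, hT⟩ := ih
      obtain ⟨S, hiS, hS⟩ := hsingle i
      refine ⟨S ∩ T, ?_, hinter S T hS hT⟩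
      rw [Finset.disjoint_insert_left]
      exact ⟨fun h => hiS (Finset.mem_inter.1 h).1, hJT.mono_right Finset.inter_subset_right⟩
  obtain ⟨T, hdisj, hT⟩ := hall Finset.univ
  have hempty : T = ∅ :=
    Finset.eq_empty_of_forall_notMem fun i hi =>
      Finset.disjoint_left.1 hdisj (Finset.mem_univ i) hi
  refine hb (hT.symm.trans ?_)
  simpa [tup, hempty] using hF f hf 2

theorem collapsible_polSet_of_zhuk (hab : a ≠ b) (ha : a ≠ 2) (hb : b ≠ 2) (hs : sOp ∈ F)
    (hF : ∀ g ∈ F, Idem g.2) (hFb : ∀ g ∈ F, PreservesSet g.2 {b, 2}) (hnc : ¬ Collapsible F)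
    {f : Op} (hf : f ∈ F) (hproj : ¬ Proj0212 f.2)
    {p : D → D → D} (hp : IsTerm2 F p) (hpab : p a b = a) (hpa2 : p a 2 = 2)
    {r : D → D → D → D} (hr : IsTerm3 F r) (hr₁ : r a a b = a) (hr₂ : r a b a = a)
    (hr₃ : r a b b = 2) {Δ : Set RelD} (hfin : Δ.Finite) (hsub : ∀ ρ ∈ Δ, InInv F ρ.2) :
    Collapsible (PolSet Δ) := by
  have hm := isTerm2_meet hs
  obtain ⟨v, hv, hvab, hva2, hvba⟩ : ∃ v, IsTerm2 F v ∧ v a b = a ∧ v a 2 = 2 ∧ v b a = 2 := by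
    obtain ⟨v, hv, hvab, hvba⟩ := exists_asymmetric_term hab ha hb hs hF hnc hf hproj
    exact ⟨fun x y => meet (v x y) (p x y), hm.comp hv hp, by simp [hvab, hpab], by simp [hpa2],
      by simp [hvba]⟩
  by_cases hV : ∃ V, IsTerm2 F V ∧ V a b = a ∧ V b 2 = 2
  · obtain ⟨V, hV, hVab, hVb2⟩ := hV
    refine collapsible_polSet_of_terms (E := {b}) (w := fun x y => meet (v x y) (V x y))
      hab.symm hb ha hs hF rfl (hm.comp hv hV) ?_ ?_ ?_ hr ?_ ?_ ?_ hfin hsub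
    · rintro e rfl
      simp [hvab, hVab]
    · intro e he hea
      obtain rfl : e = 2 := by
        rcases D_cases hab ha hb e with h | h | h
        exacts [absurd h hea, absurd h he, h]
      simp [hva2]
    · intro e he
      rcases D_cases hab ha hb e with rfl | rfl | rfl
      · simp [hvba]
      · exact absurd rfl he
      · simp [hVb2]
    · rintro e rfl; exact hr₂
    · rintro e rfl; exact hr₁
    · rintro e rfl e' rfl; exact hr₃
  replace hV : ∀ V, IsTerm2 F V → V a b = a → V b 2 = b := fun V hT h =>
    (hT.two_or hFb).resolve_right fun h2 => hV ⟨V, hT, h, h2⟩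
  have hvb2 := hV v hv hvab
  let w : D → D → D := fun x y => v x (meet x y)
  have hw : IsTerm2 F w := hv.comp (.proj 0) (hm.comp (.proj 0) (.proj 1))
  have hwba : w b a = b := by simp [w, meet_of_ne hab.symm, hvb2]
  have hwb2 : w b 2 = b := by simp [w, hvb2]
  have hwa : ∀ e, e ≠ a → w a e = 2 := fun e he => by simp [w, meet_of_ne he.symm, hva2]
  let q : D → D → D → D := fun x y z => v x (meet y z)
  have hq : IsTerm3 F q := hv.comp (.proj 0) (hm.comp (.proj 1) (.proj 2))
  have hqaa : q b a a = 2 := by simp [q, hvba]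
  have hqab : q b a b = b := by simp [q, meet_of_ne hab, hvb2]
  have hqba : q b b a = b := by simp [q, meet_of_ne hab.symm, hvb2]
  by_cases hW : ∃ W, IsTerm2 F W ∧ W b a = b ∧ W b 2 = 2
  · obtain ⟨W, hW, hWba, hWb2⟩ := hW
    refine collapsible_polSet_of_terms (E := {a}) (w := fun x y => meet (w x y) (W x y))
      hab ha hb hs hF rfl (hm.comp hw hW) ?_ ?_ ?_ hq ?_ ?_ ?_ hfin hsub
    · rintro e rfl
      simp [hwba, hWba]
    · intro e he heb
      obtain rfl : e = 2 := by
        rcases D_cases hab ha hb e with h | h | h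
        exacts [absurd h he, absurd h heb, h]
      simp [hWb2]
    · intro e he
      simp [hwa e he]
    · rintro e rfl; exact hqab
    · rintro e rfl; exact hqba
    · rintro e rfl e' rfl; exact hqaa
  replace hW : ∀ W, IsTerm2 F W → W b a = b → W b 2 = b := fun W hT h =>
    (hT.two_or hFb).resolve_right fun h2 => hW ⟨W, hT, h, h2⟩
  obtain ⟨g, hg, hgbba, hgb2b, hgb22⟩ :=
    exists_double_drop_term hab ha hb hs hF hFb hV hW hf hproj
  have hgbb2 : g b b 2 = b :=
    hW (fun x y => g x x y) (hg.comp (.proj 0) (.proj 0) (.proj 1)) hgbba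
  have hκ : IsTerm3 F fun x y z =>
      meet (meet (g x (meet x y) z) (g x (meet x z) y)) (q x y z) :=
    hm.comp (hm.comp (hg.comp (.proj 0) (hm.comp (.proj 0) (.proj 1)) (.proj 2))
      (hg.comp (.proj 0) (hm.comp (.proj 0) (.proj 2)) (.proj 1))) hq
  refine collapsible_polSet_of_terms (E := {a, 2}) hab ha hb hs hF (by simp) hw ?_ ?_ hwa hκ
    ?_ ?_ ?_ hfin hsub
  · rintro e (rfl | rfl)
    exacts [hwba, hwb2]
  · intro e he heb
    rcases D_cases hab ha hb e with rfl | rfl | rfl <;> simp at he heb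
  · rintro e (rfl | rfl)
    · simp [meet_of_ne hab.symm, hgb2b, hgbba, hqab]
    · simp [hgb2b, hgbb2, q, hvb2]
  · rintro e (rfl | rfl)
    · simp [meet_of_ne hab.symm, hgb2b, hgbba, hqba]
    · simp [hgb2b, hgbb2, q, hvb2]
  · rintro e (rfl | rfl) e' (rfl | rfl)
    · simp [hqaa]
    · simp [meet_of_ne hab.symm, hgb22]
    · simp [meet_of_ne hab.symm, hgb22]
    · simp [hgb22]

end Construction

theorem statement13 (F : Set Op) (hgap : GapAlgebra F)
    (hproj : ∃ g ∈ F, ¬ Proj0212 g.2)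
    (hzhuk : ZhukCondition F)
    (Δ : Set RelD) (hfin : Δ.Finite) (hsub : ∀ ρ ∈ Δ, InInv F ρ.2) :
    Collapsible (PolSet Δ) := by
  obtain ⟨hs, hF, hnc⟩ := hgap
  obtain ⟨g, hg, hgproj⟩ := hproj
  obtain ⟨p, r, hp, hr, -, -, ⟨h₁, h₂, h₃, h₄, h₅⟩ | ⟨h₁, h₂, h₃, h₄, h₅⟩⟩ := hzhuk
  · exact collapsible_polSet_of_zhuk (a := 0) (b := 1) (p := fun x y => p ![x, y])
      (r := fun x y z => r ![x, y, z]) (by decide) (by decide) (by decide) hs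
      (fun g hg => (hF g hg).1) (fun g hg => (hF g hg).2.2) hnc hg hgproj
      (hp.comp2 (.proj 0) (.proj 1)) h₁ h₂ (hr.comp3 (.proj 0) (.proj 1) (.proj 2)) h₃ h₄ h₅
      hfin hsub
  · exact collapsible_polSet_of_zhuk (a := 1) (b := 0) (p := fun x y => p ![y, x])
      (r := fun x y z => r ![x, y, z]) (by decide) (by decide) (by decide) hs
      (fun g hg => (hF g hg).1) (fun g hg => (hF g hg).2.1) hnc hg hgproj
      (hp.comp2 (.proj 1) (.proj 0)) h₁ h₂ (hr.comp3 (.proj 0) (.proj 1) (.proj 2)) h₄ h₃ h₅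
      hfin hsub
end
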